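/- arXiv:2011.10985 — 4 statements merged into one kernel-verified Lean document; each statement's English description precedes it below -/
import Mathlib

section
/- Let d ≥ 1, let h : ℝ^d → ℝ be 1-Lipschitz, and for t > 0 define the Gaussian smoothing P_t h(x) = (2πt)^{−d/2} ∫_{ℝ^d} e^{−|y−x|²/(2t)} h(y) dy. Then P_t h is twice continuously differentiable and for all x, v, v₁, v₂ ∈ ℝ^d, |⟨∇²(P_t h)(x+v) − ∇²(P_t h)(x), v₁ v₂^T⟩_HS| ≤ (2/t) |v₁| |v₂| |v|, where ⟨A, B⟩_HS = Σ_{i,j} A_{ij} B_{ij} and ∇² denotes the Hessian. -/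
open MeasureTheory

/-- Gaussian smoothing `P_t h(x) = (2πt)^{−d/2} ∫ e^{−|y−x|²/(2t)} h(y) dy`. -/
noncomputable def gaussSmooth (d : ℕ) (t : ℝ) (h : EuclideanSpace ℝ (Fin d) → ℝ)
    (x : EuclideanSpace ℝ (Fin d)) : ℝ :=
  (2 * Real.pi * t) ^ (-(d : ℝ) / 2) * ∫ y, Real.exp (-‖y - x‖ ^ 2 / (2 * t)) * h y

open scoped RealInnerProductSpace

section helpers

variable {E : Type*} [NormedAddCommGroup E] [InnerProductSpace ℝ E] [FiniteDimensional ℝ E]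
  [MeasurableSpace E] [BorelSpace E]

lemma gs_bound {n : ℕ} {x y : E} {R A C k H : ℝ} (hx : ‖x‖ ≤ R) (hA : 0 ≤ A) (hk : 0 ≤ k)
    (hH : |H| ≤ A * (1 + ‖y‖)) (hC : (1 + ‖y - x‖) ^ (n + 2) * k ≤ C) :
    k * |H| ≤ A * C * (1 + R) ^ (n + 2) * ((1 + ‖y‖) ^ (n + 1))⁻¹ := by
  have hR : 0 ≤ R := (norm_nonneg x).trans hx
  have h1 : 1 + ‖y‖ ≤ (1 + R) * (1 + ‖y - x‖) := by
    have : ‖y‖ ≤ ‖y - x‖ + ‖x‖ := by simpa using norm_add_le (y - x) x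
    nlinarith [norm_nonneg (y - x)]
  rw [← div_eq_mul_inv, le_div_iff₀ (by positivity)]
  calc k * |H| * (1 + ‖y‖) ^ (n + 1) ≤ k * (A * (1 + ‖y‖)) * (1 + ‖y‖) ^ (n + 1) := by gcongr
    _ = k * A * (1 + ‖y‖) ^ (n + 2) := by ring
    _ ≤ k * A * ((1 + R) * (1 + ‖y - x‖)) ^ (n + 2) := by gcongr
    _ = A * ((1 + ‖y - x‖) ^ (n + 2) * k) * (1 + R) ^ (n + 2) := by rw [mul_pow]; ring
    _ ≤ A * C * (1 + R) ^ (n + 2) := by gcongr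

lemma gs_dom_integrable (c : ℝ) :
    Integrable (fun y : E => c * ((1 + ‖y‖) ^ (Module.finrank ℝ E + 1))⁻¹) := by
  refine Integrable.const_mul ?_ c
  have := integrable_one_add_norm (E := E) (μ := volume)
    (r := ((Module.finrank ℝ E + 1 : ℕ) : ℝ)) (by push_cast; linarith)
  refine this.congr (Filter.Eventually.of_forall fun y => ?_)
  simp only
  rw [Real.rpow_neg (by positivity), Real.rpow_natCast]

def GsDec {G : Type*} [NormedAddCommGroup G] (K : E → G) : Prop :=
  ∃ C, ∀ z, (1 + ‖z‖) ^ (Module.finrank ℝ E + 2) * ‖K z‖ ≤ C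

lemma gs_integrable {G : Type*} [NormedAddCommGroup G] [NormedSpace ℝ G] {K : E → G}
    (hK : Continuous K) (hd : GsDec K) {h : E → ℝ} (hh : Continuous h) {A : ℝ} (hA : 0 ≤ A)
    (hb : ∀ y, |h y| ≤ A * (1 + ‖y‖)) (x : E) :
    Integrable (fun y => h y • K (y - x)) := by
  obtain ⟨C, hC⟩ := hd
  refine (gs_dom_integrable (E := E) (A * C * (1 + ‖x‖) ^ (Module.finrank ℝ E + 2))).mono'
    (by fun_prop : Continuous (fun y => h y • K (y - x))).aestronglyMeasurable
    (Filter.Eventually.of_forall fun y => ?_)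
  rw [norm_smul, mul_comm, Real.norm_eq_abs]
  exact gs_bound le_rfl hA (norm_nonneg _) (hb y) (hC _)

lemma gs_continuous {G : Type*} [NormedAddCommGroup G] [NormedSpace ℝ G] {K : E → G}
    (hK : Continuous K) (hd : GsDec K) {h : E → ℝ} (hh : Continuous h) {A : ℝ} (hA : 0 ≤ A)
    (hb : ∀ y, |h y| ≤ A * (1 + ‖y‖)) :
    Continuous (fun x => ∫ y, h y • K (y - x)) := by
  obtain ⟨C, hC⟩ := hd
  rw [continuous_iff_continuousAt]
  intro x₀
  refine continuousAt_of_dominated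
    (bound := fun y => A * C * (1 + (‖x₀‖ + 1)) ^ (Module.finrank ℝ E + 2) *
      ((1 + ‖y‖) ^ (Module.finrank ℝ E + 1))⁻¹)
    (Filter.Eventually.of_forall fun x =>
      (by fun_prop : Continuous (fun y => h y • K (y - x))).aestronglyMeasurable) ?_
    (gs_dom_integrable _) (Filter.Eventually.of_forall fun y => by fun_prop)
  filter_upwards [Metric.ball_mem_nhds x₀ one_pos] with x hx
  refine Filter.Eventually.of_forall fun y => ?_
  rw [norm_smul, mul_comm, Real.norm_eq_abs]
  refine gs_bound ?_ hA (norm_nonneg _) (hb y) (hC _)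
  rw [mem_ball_iff_norm] at hx
  have : ‖x‖ ≤ ‖x - x₀‖ + ‖x₀‖ := by simpa using norm_add_le (x - x₀) x₀
  linarith

lemma gs_hasFDerivAt {K : E → ℝ} {K' : E → E →L[ℝ] ℝ}
    (hKd : ∀ z, HasFDerivAt K (K' z) z)
    (hd : GsDec K) (hK' : Continuous K') (hd' : GsDec K')
    {h : E → ℝ} (hh : Continuous h) {A : ℝ} (hA : 0 ≤ A)
    (hb : ∀ y, |h y| ≤ A * (1 + ‖y‖)) (x₀ : E) :
    HasFDerivAt (fun x => ∫ y, h y • K (y - x)) (∫ y, h y • -K' (y - x₀)) x₀ := by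
  have hK : Continuous K := continuous_iff_continuousAt.2 fun z => (hKd z).continuousAt
  obtain ⟨C, hC⟩ := hd'
  refine hasFDerivAt_integral_of_dominated_of_fderiv_le (F' := fun x y => h y • -K' (y - x))
    (bound := fun y => A * C * (1 + (‖x₀‖ + 1)) ^ (Module.finrank ℝ E + 2) *
      ((1 + ‖y‖) ^ (Module.finrank ℝ E + 1))⁻¹)
    (Metric.ball_mem_nhds x₀ one_pos)
    (Filter.Eventually.of_forall fun x =>
      (by fun_prop : Continuous (fun y => h y • K (y - x))).aestronglyMeasurable)
    (gs_integrable hK hd hh hA hb x₀)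
    (by fun_prop : Continuous (fun y => h y • -K' (y - x₀))).aestronglyMeasurable
    ?_ (gs_dom_integrable _) ?_
  · refine Filter.Eventually.of_forall fun y x hx => ?_
    rw [norm_smul, mul_comm, Real.norm_eq_abs, norm_neg]
    refine gs_bound ?_ hA (norm_nonneg _) (hb y) (hC _)
    rw [mem_ball_iff_norm] at hx
    have : ‖x‖ ≤ ‖x - x₀‖ + ‖x₀‖ := by simpa using norm_add_le (x - x₀) x₀
    linarith
  · refine Filter.Eventually.of_forall fun y x hx => ?_
    have h1 : HasFDerivAt (fun x => y - x) (-ContinuousLinearMap.id ℝ E) x :=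
      (hasFDerivAt_id x).const_sub y
    have h2 := ((hKd (y - x)).comp x h1).const_smul (h y)
    have e3 : h y • -K' (y - x) = h y • (K' (y - x)).comp (-ContinuousLinearMap.id ℝ E) := by
      ext v; simp
    rw [e3]
    exact h2

lemma gs_fderiv_apply {K : E → ℝ} {K' : E → E →L[ℝ] ℝ}
    (hKd : ∀ z, HasFDerivAt K (K' z) z)
    (hd : GsDec K) (hK' : Continuous K') (hd' : GsDec K')
    {h : E → ℝ} (hh : Continuous h) {A : ℝ} (hA : 0 ≤ A)
    (hb : ∀ y, |h y| ≤ A * (1 + ‖y‖)) (x v : E) :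
    fderiv ℝ (fun x => ∫ y, h y • K (y - x)) x v = ∫ y, h y • -(K' (y - x) v) := by
  rw [(gs_hasFDerivAt hKd hd hK' hd' hh hA hb x).fderiv, ContinuousLinearMap.integral_apply]
  · simp
  · have := gs_integrable hK' hd' hh hA hb x
    simpa using this.neg

/-- Gaussian kernel. -/
noncomputable def gsG (t : ℝ) (z : E) : ℝ := Real.exp (-‖z‖ ^ 2 / (2 * t))

lemma gsG_pos (t : ℝ) (z : E) : 0 < gsG t z := Real.exp_pos _

lemma gsG_continuous (t : ℝ) : Continuous (gsG (E := E) t) := by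
  unfold gsG; fun_prop

lemma gs_dec {G : Type*} [NormedAddCommGroup G] {t : ℝ} (ht : 0 < t) {K : E → G} {B : ℝ}
    (hB : 0 ≤ B) (hK : ∀ z, ‖K z‖ ≤ B * (1 + ‖z‖) ^ 2 * gsG t z) : GsDec K := by
  set m := Module.finrank ℝ E + 4 with hm
  refine ⟨B * (m.factorial * Real.exp (1 + t / 2)), fun z => ?_⟩
  set s := ‖z‖ with hs
  have hs0 : 0 ≤ s := norm_nonneg z
  have h1 := Real.pow_div_factorial_le_exp (1 + s) (by positivity) m
  rw [div_le_iff₀ (by positivity)] at h1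
  have h2 : Real.exp (1 + s) * gsG t z ≤ Real.exp (1 + t / 2) := by
    rw [gsG, ← Real.exp_add]
    apply Real.exp_le_exp.2
    have : -s ^ 2 / (2 * t) = t / 2 - s - (s - t) ^ 2 / (2 * t) := by field_simp; ring
    rw [← hs, this]
    have : 0 ≤ (s - t) ^ 2 / (2 * t) := by positivity
    linarith
  have hg := gsG_pos t z
  calc (1 + s) ^ (Module.finrank ℝ E + 2) * ‖K z‖
      ≤ (1 + s) ^ (Module.finrank ℝ E + 2) * (B * (1 + s) ^ 2 * gsG t z) := by
        gcongr; exact hK z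
    _ = B * ((1 + s) ^ m * gsG t z) := by rw [hm]; ring
    _ ≤ B * (Real.exp (1 + s) * m.factorial * gsG t z) := by gcongr
    _ = B * (m.factorial * (Real.exp (1 + s) * gsG t z)) := by ring
    _ ≤ _ := by gcongr

noncomputable def gsG' (t : ℝ) (z : E) : E →L[ℝ] ℝ := (-(gsG t z / t)) • innerSL ℝ z

lemma gsG_hasFDerivAt {t : ℝ} (z : E) : HasFDerivAt (gsG t) (gsG' t z) z := by
  have h := (((hasStrictFDerivAt_norm_sq z).hasFDerivAt.neg).mul_const ((2 * t)⁻¹)).exp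
  have e : (gsG t : E → ℝ) = fun x => Real.exp (-‖x‖ ^ 2 * (2 * t)⁻¹) := by
    funext x; simp [gsG, div_eq_mul_inv]
  have e3 : gsG' t z = Real.exp (-‖z‖ ^ 2 * (2 * t)⁻¹) • (2 * t)⁻¹ • -(2 • (innerSL ℝ) z) := by
    ext v
    simp [gsG', gsG, div_eq_mul_inv]
    ring
  rw [e, e3]
  exact h

noncomputable def gsK1 (t : ℝ) (v z : E) : ℝ := gsG t z * (⟪z, v⟫ / t)

noncomputable def gsK1' (t : ℝ) (v z : E) : E →L[ℝ] ℝ :=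
  gsG t z • ((1 / t) • innerSL ℝ v) + (⟪z, v⟫ / t) • gsG' t z

lemma gsK1_hasFDerivAt {t : ℝ} (v z : E) : HasFDerivAt (gsK1 t v) (gsK1' t v z) z := by
  have h1 : HasFDerivAt (fun z : E => ⟪z, v⟫ / t) ((1 / t) • innerSL ℝ v) z := by
    have := ((innerSL ℝ v).hasFDerivAt (x := z)).const_smul (1 / t)
    refine this.congr_of_eventuallyEq (Filter.Eventually.of_forall fun y => ?_)
    simp [real_inner_comm, div_eq_inv_mul]
  exact (gsG_hasFDerivAt z).mul h1

noncomputable def gsK2 (t : ℝ) (v w z : E) : ℝ :=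
  gsG t z * (⟪z, v⟫ * ⟪z, w⟫ / t ^ 2 - ⟪v, w⟫ / t)

lemma gsK1'_apply {t : ℝ} (v w z : E) : -(gsK1' t v z w) = gsK2 t v w z := by
  simp [gsK1', gsG', gsK2]; ring

lemma gsG'_apply {t : ℝ} (v z : E) : -(gsG' t z v) = gsK1 t v z := by
  simp [gsG', gsK1]; ring

lemma gsG'_continuous (t : ℝ) : Continuous (gsG' (E := E) t) := by
  have := gsG_continuous (E := E) t
  unfold gsG'; fun_prop

lemma gsK1'_continuous (t : ℝ) (v : E) : Continuous (gsK1' t v) := by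
  have := gsG_continuous (E := E) t
  have := gsG'_continuous (E := E) t
  unfold gsK1'; fun_prop

lemma gsK2_continuous (t : ℝ) (v w : E) : Continuous (gsK2 t v w) := by
  have := gsG_continuous (E := E) t
  unfold gsK2; fun_prop

lemma gsG_dec {t : ℝ} (ht : 0 < t) : GsDec (gsG (E := E) t) := by
  refine gs_dec ht zero_le_one fun z => ?_
  have hg := gsG_pos t z
  rw [Real.norm_eq_abs, abs_of_pos hg]
  have : 1 ≤ (1 + ‖z‖) ^ 2 := by nlinarith [norm_nonneg z]
  nlinarith

lemma gsG'_norm {t : ℝ} (ht : 0 < t) (z : E) : ‖gsG' t z‖ = gsG t z / t * ‖z‖ := by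
  have hg := gsG_pos t z
  rw [gsG', norm_smul, norm_neg, Real.norm_eq_abs, abs_of_pos (by positivity), innerSL_apply_norm]

lemma gsG'_dec {t : ℝ} (ht : 0 < t) : GsDec (gsG' (E := E) t) := by
  refine gs_dec (B := 1 / t) ht (by positivity) fun z => ?_
  have hg := gsG_pos t z
  rw [gsG'_norm ht]
  have : ‖z‖ ≤ (1 + ‖z‖) ^ 2 := by nlinarith [norm_nonneg z]
  calc gsG t z / t * ‖z‖ ≤ gsG t z / t * (1 + ‖z‖) ^ 2 := by gcongr
    _ = _ := by ring

lemma gsK1_dec {t : ℝ} (ht : 0 < t) (v : E) : GsDec (gsK1 t v) := by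
  refine gs_dec (B := ‖v‖ / t) ht (by positivity) fun z => ?_
  have hg := gsG_pos t z
  rw [gsK1, norm_mul, norm_div, Real.norm_eq_abs, abs_of_pos hg, Real.norm_of_nonneg ht.le]
  have h1 : ‖z‖ ≤ (1 + ‖z‖) ^ 2 := by nlinarith [norm_nonneg z]
  have h2 := norm_inner_le_norm (𝕜 := ℝ) z v
  calc gsG t z * (‖⟪z, v⟫‖ / t) ≤ gsG t z * (((1 + ‖z‖) ^ 2 * ‖v‖) / t) := by
        gcongr; exact h2.trans (by gcongr)
    _ = _ := by ring

lemma gsK1'_dec {t : ℝ} (ht : 0 < t) (v : E) : GsDec (gsK1' t v) := by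
  refine gs_dec (B := ‖v‖ / t + ‖v‖ / t ^ 2) ht (by positivity) fun z => ?_
  have hg := gsG_pos t z
  have h2 := norm_inner_le_norm (𝕜 := ℝ) z v
  have h3 : 1 ≤ (1 + ‖z‖) ^ 2 := by nlinarith [norm_nonneg z]
  have h4 : ‖z‖ * ‖z‖ ≤ (1 + ‖z‖) ^ 2 := by nlinarith [norm_nonneg z]
  calc ‖gsK1' t v z‖ ≤ ‖gsG t z • ((1 / t) • innerSL ℝ v)‖ + ‖(⟪z, v⟫ / t) • gsG' t z‖ :=
        norm_add_le _ _
    _ = gsG t z * (1 / t * ‖v‖) + ‖⟪z, v⟫‖ / t * (gsG t z / t * ‖z‖) := by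
        rw [norm_smul, norm_smul, norm_smul, gsG'_norm ht, innerSL_apply_norm, norm_div ⟪z, v⟫,
          Real.norm_of_nonneg hg.le, Real.norm_of_nonneg ht.le,
          Real.norm_of_nonneg (by positivity : 0 ≤ 1 / t)]
    _ ≤ gsG t z * (1 / t * ‖v‖) + (‖z‖ * ‖v‖) / t * (gsG t z / t * ‖z‖) := by gcongr
    _ = gsG t z * (1 / t * ‖v‖) * 1 + (‖v‖ / t ^ 2 * gsG t z) * (‖z‖ * ‖z‖) := by
        field_simp
    _ ≤ gsG t z * (1 / t * ‖v‖) * (1 + ‖z‖) ^ 2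
        + (‖v‖ / t ^ 2 * gsG t z) * (1 + ‖z‖) ^ 2 := by gcongr
    _ = _ := by ring

lemma gsK2_dec {t : ℝ} (ht : 0 < t) (v w : E) : GsDec (gsK2 t v w) := by
  obtain ⟨C, hC⟩ := gsK1'_dec ht v
  refine ⟨C * ‖w‖, fun z => ?_⟩
  rw [← gsK1'_apply, norm_neg]
  calc (1 + ‖z‖) ^ (Module.finrank ℝ E + 2) * ‖gsK1' t v z w‖
      ≤ (1 + ‖z‖) ^ (Module.finrank ℝ E + 2) * (‖gsK1' t v z‖ * ‖w‖) := by
        gcongr; exact ContinuousLinearMap.le_opNorm _ _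
    _ = (1 + ‖z‖) ^ (Module.finrank ℝ E + 2) * ‖gsK1' t v z‖ * ‖w‖ := by ring
    _ ≤ _ := by gcongr; exact hC z

lemma gs_fderiv1 {t : ℝ} (ht : 0 < t) {h : E → ℝ} (hh : Continuous h) {A : ℝ} (hA : 0 ≤ A)
    (hb : ∀ y, |h y| ≤ A * (1 + ‖y‖)) (x v : E) :
    fderiv ℝ (fun x => ∫ y, h y • gsG t (y - x)) x v = ∫ y, h y • gsK1 t v (y - x) := by
  rw [gs_fderiv_apply gsG_hasFDerivAt (gsG_dec ht) (gsG'_continuous t) (gsG'_dec ht) hh hA hb]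
  simp only [gsG'_apply]

lemma gs_fderiv2 {t : ℝ} (ht : 0 < t) {h : E → ℝ} (hh : Continuous h) {A : ℝ} (hA : 0 ≤ A)
    (hb : ∀ y, |h y| ≤ A * (1 + ‖y‖)) (x v w : E) :
    fderiv ℝ (fun x => ∫ y, h y • gsK1 t v (y - x)) x w = ∫ y, h y • gsK2 t v w (y - x) := by
  rw [gs_fderiv_apply (gsK1_hasFDerivAt v) (gsK1_dec ht v) (gsK1'_continuous t v) (gsK1'_dec ht v)
    hh hA hb]
  simp only [gsK1'_apply]

lemma gs_contDiff {t : ℝ} (ht : 0 < t) {h : E → ℝ} (hh : Continuous h) {A : ℝ} (hA : 0 ≤ A)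
    (hb : ∀ y, |h y| ≤ A * (1 + ‖y‖)) : ContDiff ℝ 2 (fun x => ∫ y, h y • gsG t (y - x)) := by
  have e : (2 : WithTop ℕ∞) = 1 + 1 := by norm_num
  rw [e, contDiff_succ_iff_fderiv_apply]
  refine ⟨fun x => (gs_hasFDerivAt gsG_hasFDerivAt (gsG_dec ht) (gsG'_continuous t) (gsG'_dec ht)
    hh hA hb x).differentiableAt, fun h => by simp at h, fun v => ?_⟩
  simp only [gs_fderiv1 ht hh hA hb]
  have e : (1 : WithTop ℕ∞) = 0 + 1 := by norm_num
  rw [e, contDiff_succ_iff_fderiv_apply]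
  refine ⟨fun x => (gs_hasFDerivAt (gsK1_hasFDerivAt v) (gsK1_dec ht v) (gsK1'_continuous t v)
    (gsK1'_dec ht v) hh hA hb x).differentiableAt, fun h => by simp at h, fun w => ?_⟩
  simp only [gs_fderiv2 ht hh hA hb]
  rw [contDiff_zero]
  exact gs_continuous (gsK2_continuous t v w) (gsK2_dec ht v w) hh hA hb


lemma gs_int {G : Type*} [NormedAddCommGroup G] [NormedSpace ℝ G] {K : E → G}
    (hK : Continuous K) (hd : GsDec K) : Integrable K := by
  have := gs_integrable hK hd (h := fun _ => 1) continuous_const zero_le_one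
    (fun y => by simp) 0
  simpa using this

/-- The second derivative kernel integrates to zero. -/
lemma gsK2_integral {t : ℝ} (ht : 0 < t) (v w : E) : ∫ z, gsK2 t v w z = 0 := by
  have hb : ∀ y : E, |(fun _ => 1 : E → ℝ) y| ≤ 1 * (1 + ‖y‖) := fun y => by simp
  have h1 := gs_fderiv1 ht (continuous_const) zero_le_one hb
  have h2 := gs_fderiv2 ht (continuous_const) zero_le_one hb 0 v w
  simp only [one_smul, integral_sub_right_eq_self (μ := (volume : Measure E)), fderiv_fun_const,
    sub_zero] at h1 h2
  rw [← h2]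
  simp

lemma gs_second_moment {t : ℝ} (ht : 0 < t) (v : E) :
    Integrable (fun z => gsG t z * ⟪z, v⟫ ^ 2) ∧
    ∫ z, gsG t z * ⟪z, v⟫ ^ 2 = t * ‖v‖ ^ 2 * ∫ z : E, gsG t z := by
  have e : (fun z => gsG t z * ⟪z, v⟫ ^ 2) =
      fun z => t ^ 2 * gsK2 t v v z + t * ‖v‖ ^ 2 * gsG t z := by
    funext z
    rw [gsK2, real_inner_self_eq_norm_sq]; field_simp; ring
  have i1 := (gs_int (gsK2_continuous t v v) (gsK2_dec ht v v)).const_mul (t ^ 2)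
  have i2 := (gs_int (gsG_continuous (E := E) t) (gsG_dec ht)).const_mul (t * ‖v‖ ^ 2)
  rw [e]
  refine ⟨i1.add i2, ?_⟩
  rw [integral_add i1 i2, integral_const_mul, integral_const_mul, gsK2_integral ht]
  simp

lemma gsK2_abs_integral {t : ℝ} (ht : 0 < t) (v w : E) :
    ∫ z, |gsK2 t v w z| ≤ 2 / t * (‖v‖ * ‖w‖) * ∫ z : E, gsG t z := by
  rcases eq_or_ne v 0 with rfl | hv
  · simp [gsK2]
  rcases eq_or_ne w 0 with rfl | hw
  · simp [gsK2]
  have hv := norm_pos_iff.2 hv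
  have hw := norm_pos_iff.2 hw
  obtain ⟨iv, ev⟩ := gs_second_moment ht v
  obtain ⟨iw, ew⟩ := gs_second_moment ht w
  have i2 := (gs_int (gsG_continuous (E := E) t) (gsG_dec ht)).const_mul (‖v‖ * ‖w‖ / t)
  have iv := iv.const_mul (‖w‖ / ‖v‖ / (2 * t ^ 2))
  have iw := iw.const_mul (‖v‖ / ‖w‖ / (2 * t ^ 2))
  have key : ∫ z, |gsK2 t v w z| ≤ ∫ z, (‖w‖ / ‖v‖ / (2 * t ^ 2) * (gsG t z * ⟪z, v⟫ ^ 2)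
      + ‖v‖ / ‖w‖ / (2 * t ^ 2) * (gsG t z * ⟪z, w⟫ ^ 2)) + ‖v‖ * ‖w‖ / t * gsG t z := by
    refine integral_mono (gs_int (gsK2_continuous t v w) (gsK2_dec ht v w)).abs
      ((iv.add iw).add i2) fun z => ?_
    have hg := gsG_pos t z
    simp only
    rw [gsK2, abs_mul, abs_of_pos hg]
    have h1 : |⟪z, v⟫ * ⟪z, w⟫ / t ^ 2 - ⟪v, w⟫ / t| ≤
        |⟪z, v⟫| * |⟪z, w⟫| / t ^ 2 + ‖v‖ * ‖w‖ / t := by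
      refine (abs_sub _ _).trans ?_
      rw [abs_div, abs_div, abs_mul, abs_of_pos ht, abs_of_pos (pow_pos ht 2)]
      gcongr
      exact abs_real_inner_le_norm v w
    have h2 : |⟪z, v⟫| * |⟪z, w⟫| ≤ (‖w‖ / ‖v‖ * ⟪z, v⟫ ^ 2 + ‖v‖ / ‖w‖ * ⟪z, w⟫ ^ 2) / 2 := by
      rw [← sq_abs ⟪z, v⟫, ← sq_abs ⟪z, w⟫]
      generalize |⟪z, v⟫| = a
      generalize |⟪z, w⟫| = b
      have : (‖w‖ / ‖v‖ * a ^ 2 + ‖v‖ / ‖w‖ * b ^ 2) / 2 - a * b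
        = (‖w‖ * a - ‖v‖ * b) ^ 2 / (2 * ‖v‖ * ‖w‖) := by field_simp; ring
      have : 0 ≤ (‖w‖ * a - ‖v‖ * b) ^ 2 / (2 * ‖v‖ * ‖w‖) := by positivity
      linarith
    calc _ ≤ gsG t z * (((‖w‖ / ‖v‖ * ⟪z, v⟫ ^ 2 + ‖v‖ / ‖w‖ * ⟪z, w⟫ ^ 2) / 2) / t ^ 2
          + ‖v‖ * ‖w‖ / t) := by
          gcongr; exact h1.trans (by gcongr)
      _ = _ := by field_simp
  refine key.trans_eq ?_
  rw [integral_add (by exact iv.add iw) i2, integral_add iv iw, integral_const_mul, integral_const_mul,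
    integral_const_mul, ev, ew]
  field_simp
  ring

lemma gs_lip_bound {h : E → ℝ} (hL : LipschitzWith 1 h) (y : E) :
    |h y| ≤ (1 + |h 0|) * (1 + ‖y‖) := by
  have := hL.dist_le_mul y 0
  simp [Real.dist_eq] at this
  have h2 : |h y| ≤ |h y - h 0| + |h 0| := by simpa using abs_add_le (h y - h 0) (h 0)
  nlinarith [abs_nonneg (h 0), norm_nonneg y]

lemma gs_main {t : ℝ} (ht : 0 < t) {h : E → ℝ} (hL : LipschitzWith 1 h) (x v v₁ v₂ : E) :
    |(∫ y, h y • gsK2 t v₁ v₂ (y - (x + v))) - ∫ y, h y • gsK2 t v₁ v₂ (y - x)| ≤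
      2 / t * (‖v₁‖ * ‖v₂‖ * ‖v‖) * ∫ z : E, gsG t z := by
  have tr : ∀ x : E, (∫ y, h y • gsK2 t v₁ v₂ (y - x)) = ∫ z, h (z + x) • gsK2 t v₁ v₂ z := by
    intro x
    rw [← integral_add_right_eq_self _ x]; simp
  have ti : ∀ x : E, Integrable (fun z => h (z + x) • gsK2 t v₁ v₂ z) := by
    intro x
    have := (gs_integrable (gsK2_continuous t v₁ v₂) (gsK2_dec ht v₁ v₂) hL.continuous
      (by positivity) (gs_lip_bound hL) x).comp_add_right x
    simpa using this
  have i2 := (gs_int (gsK2_continuous t v₁ v₂) (gsK2_dec ht v₁ v₂)).abs.const_mul ‖v‖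
  rw [tr, tr, ← integral_sub (ti _) (ti _), ← Real.norm_eq_abs]
  calc _ ≤ ∫ z, ‖v‖ * |gsK2 t v₁ v₂ z| := by
        refine norm_integral_le_of_norm_le i2 (Filter.Eventually.of_forall fun z => ?_)
        rw [← sub_smul, norm_smul, Real.norm_eq_abs (gsK2 _ _ _ _)]
        gcongr
        have := hL.dist_le_mul (z + (x + v)) (z + x)
        rw [dist_eq_norm, dist_eq_norm] at this
        have e3 : z + (x + v) - (z + x) = v := by abel
        rw [e3] at this
        simpa using this
    _ ≤ ‖v‖ * (2 / t * (‖v₁‖ * ‖v₂‖) * ∫ z : E, gsG t z) := by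
        rw [integral_const_mul]
        gcongr
        exact gsK2_abs_integral ht v₁ v₂
    _ = _ := by ring

lemma gsG_integral {t : ℝ} (ht : 0 < t) :
    ∫ z : E, gsG t z = (2 * Real.pi * t) ^ ((Module.finrank ℝ E : ℝ) / 2) := by
  have := GaussianFourier.integral_rexp_neg_mul_sq_norm (V := E) (b := (2 * t)⁻¹) (by positivity)
  have e : Real.pi / (2 * t)⁻¹ = 2 * Real.pi * t := by field_simp
  rw [e] at this
  rw [← this]
  congr 1; funext z; rw [gsG]; congr 1; field_simp

end helpers

/-- Inequality (Bp3) of Lemma 4.4: for 1-Lipschitz `h`, the Gaussian smoothing `P_t h`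
is `C²` and `|⟨∇²(P_t h)(x+v) − ∇²(P_t h)(x), v₁ v₂ᵀ⟩_HS| ≤ (2/t)|v₁||v₂||v|`,
where the Hilbert–Schmidt pairing with `v₁ v₂ᵀ` is the second directional derivative
`∇_{v₂}∇_{v₁}(P_t h)`. -/
theorem gaussSmooth_hessian_lipschitz
    {d : ℕ} (hd : 1 ≤ d) {t : ℝ} (ht : 0 < t)
    (h : EuclideanSpace ℝ (Fin d) → ℝ) (hLip : LipschitzWith 1 h) :
    ContDiff ℝ 2 (gaussSmooth d t h) ∧
      ∀ x v v₁ v₂ : EuclideanSpace ℝ (Fin d),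
        |fderiv ℝ (fun y => fderiv ℝ (gaussSmooth d t h) y v₁) (x + v) v₂ -
            fderiv ℝ (fun y => fderiv ℝ (gaussSmooth d t h) y v₁) x v₂| ≤
          2 / t * (‖v₁‖ * ‖v₂‖ * ‖v‖) := by
  set c : ℝ := (2 * Real.pi * t) ^ (-(d : ℝ) / 2) with hc
  have hc0 : 0 < c := by positivity
  have hA : 0 ≤ 1 + |h 0| := by positivity
  have hb := gs_lip_bound hLip
  have e : gaussSmooth d t h = c • fun x => ∫ y, h y • gsG t (y - x) := by
    funext x
    simp only [gaussSmooth, Pi.smul_apply, smul_eq_mul, gsG, ← hc]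
    congr 2
    funext y
    ring
  refine ⟨?_, fun x v v₁ v₂ => ?_⟩
  · rw [e]
    exact (gs_contDiff ht hLip.continuous hA hb).const_smul c
  · have e2 : ∀ x, fderiv ℝ (fun y => fderiv ℝ (gaussSmooth d t h) y v₁) x v₂ =
        c * ∫ y, h y • gsK2 t v₁ v₂ (y - x) := by
      intro x
      have e1 : (fun y => fderiv ℝ (gaussSmooth d t h) y v₁) =
          c • fun x => ∫ y, h y • gsK1 t v₁ (y - x) := by
        funext y
        rw [e, fderiv_const_smul_field]
        simp only [Pi.smul_apply, smul_apply,
          gs_fderiv1 ht hLip.continuous hA hb]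
      rw [e1, fderiv_const_smul_field]
      simp only [Pi.smul_apply, smul_apply,
          gs_fderiv2 ht hLip.continuous hA hb]
      rw [smul_eq_mul]
    rw [e2, e2, ← mul_sub, abs_mul, abs_of_pos hc0]
    have hI : c * ∫ z : EuclideanSpace ℝ (Fin d), gsG t z = 1 := by
      rw [gsG_integral ht, finrank_euclideanSpace_fin, hc,
        ← Real.rpow_add (by positivity), neg_div, neg_add_cancel, Real.rpow_zero]
    calc _ ≤ c * (2 / t * (‖v₁‖ * ‖v₂‖ * ‖v‖) * ∫ z : EuclideanSpace ℝ (Fin d), gsG t z) := by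
          gcongr; exact gs_main ht hLip x v v₁ v₂
      _ = 2 / t * (‖v₁‖ * ‖v₂‖ * ‖v‖) * (c * ∫ z : EuclideanSpace ℝ (Fin d), gsG t z) := by ring
      _ = _ := by rw [hI, mul_one]
end

section
/- Let d ≥ 1, let h : ℝ^d → ℝ be 1-Lipschitz, and for t > 0 define the Gaussian smoothing P_t h(x) = (2πt)^{−d/2} ∫_{ℝ^d} e^{−|y−x|²/(2t)} h(y) dy. Then P_t h is three times differentiable and for all x, v₁, v₂, v₃ ∈ ℝ^d the third directional derivative satisfies |∇_{v₃} ∇_{v₂} ∇_{v₁} (P_t h)(x)| ≤ (2/t) |v₁| |v₂| |v₃|. -/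
open MeasureTheory

open scoped ContDiff

namespace GaussAux

variable {d : ℕ}

local notation "VV" => EuclideanSpace ℝ (Fin d)

/-- unnormalized Gaussian kernel -/
noncomputable def gk (t : ℝ) (z : VV) : ℝ := Real.exp (-‖z‖ ^ 2 / (2 * t))

lemma gk_pos (t : ℝ) (z : VV) : 0 < gk t z := Real.exp_pos _

lemma gk_continuous (t : ℝ) : Continuous (gk (d := d) t) := by
  unfold gk; fun_prop

lemma gk_hasFDerivAt {t : ℝ} (z : VV) :
    HasFDerivAt (gk t) (-(gk t z / t) • innerSL ℝ z) z := by
  have h1 : HasFDerivAt (fun z : VV => ‖z‖ ^ 2) (2 • innerSL ℝ z) z :=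
    (hasStrictFDerivAt_norm_sq z).hasFDerivAt
  have h2 := (h1.const_mul (-(1 / (2 * t)))).exp
  have e : gk (d := d) t = fun z => Real.exp (-(1 / (2 * t)) * ‖z‖ ^ 2) := by
    funext w; unfold gk; congr 1; ring
  rw [e]
  refine h2.congr_fderiv ?_
  ext v
  simp
  ring

lemma gk_decay {t : ℝ} (ht : 0 < t) (m : ℕ) :
    ∃ C : ℝ, 0 ≤ C ∧ ∀ z : VV, (1 + ‖z‖) ^ m * gk t z ≤ C := by
  set c : ℝ := 2 + 4 * t
  refine ⟨c ^ m * (m.factorial * Real.exp 1), by positivity, fun z => ?_⟩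
  set s := ‖z‖ ^ 2 / (2 * t) with hs
  have hs0 : 0 ≤ s := by positivity
  have hz : ‖z‖ ^ 2 = 2 * t * s := by rw [hs]; field_simp
  have hn := norm_nonneg z
  have h1 : (1 + ‖z‖) ≤ c * (1 + s) := by
    have : (1 + ‖z‖) ≤ 2 + 2 * ‖z‖ ^ 2 := by nlinarith [sq_nonneg (‖z‖ - 1)]
    rw [hz] at this
    have : 0 ≤ t * s := by positivity
    simp only [c]; nlinarith
  have h2 : (1 + s) ^ m ≤ m.factorial * Real.exp (1 + s) := by
    have := Real.pow_div_factorial_le_exp (1 + s) (by positivity) m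
    rwa [div_le_iff₀' (by positivity)] at this
  have h3 : gk t z = Real.exp (-s) := by unfold gk; congr 1; rw [hs]; ring
  rw [h3]
  calc (1 + ‖z‖) ^ m * Real.exp (-s) ≤ (c * (1 + s)) ^ m * Real.exp (-s) := by gcongr
    _ = c ^ m * (1 + s) ^ m * Real.exp (-s) := by rw [mul_pow]
    _ ≤ c ^ m * (m.factorial * Real.exp (1 + s)) * Real.exp (-s) := by gcongr
    _ = c ^ m * (m.factorial * Real.exp 1) * (Real.exp s * Real.exp (-s)) := by
        rw [Real.exp_add]; ring
    _ = _ := by rw [← Real.exp_add]; simp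

variable {V : Type*} [NormedAddCommGroup V] [NormedSpace ℝ V]

/-- Domination of `gk (y - x) p (y - x) h y` for `x` near `x₀`. -/
lemma dom {t : ℝ} (ht : 0 < t) {p : VV → V} (hp : p.HasTemperateGrowth)
    {h : VV → ℝ} (hh : LipschitzWith 1 h) (x₀ : VV) :
    ∃ b : VV → ℝ, Integrable b ∧ ∀ y, ∀ x ∈ Metric.ball x₀ 1,
      ‖h y • gk t (y - x) • p (y - x)‖ ≤ b y := by
  obtain ⟨k, C, hC⟩ := hp.2 0
  simp only [norm_iteratedFDeriv_zero] at hC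
  have hC0 : 0 ≤ C := by
    have := (norm_nonneg _).trans (hC 0); simpa using this
  obtain ⟨D, hD0, hD⟩ := gk_decay (d := d) ht (k + (d + 2))
  set A := |h x₀| + 1
  refine ⟨fun y => A * (C * D * 2 ^ (d + 2)) * (1 + ‖y - x₀‖) ^ (-((d : ℝ) + 1)), ?_, ?_⟩
  · apply Integrable.const_mul
    have := integrable_one_add_norm (E := VV) (μ := volume) (r := (d : ℝ) + 1) (by simp)
    exact this.comp_sub_right x₀
  · intro y x hx
    have hx' : ‖x - x₀‖ < 1 := by rwa [← dist_eq_norm]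
    set u := 1 + ‖y - x‖ with hu
    set w := 1 + ‖y - x₀‖ with hw
    have hu1 : 1 ≤ u := by simp [hu]
    have hw1 : 1 ≤ w := by simp [hw]
    have hwu : w ≤ 2 * u := by
      have : ‖y - x₀‖ ≤ ‖y - x‖ + ‖x - x₀‖ := norm_sub_le_norm_sub_add_norm_sub _ _ _
      simp only [hw, hu]; linarith [norm_nonneg (y - x)]
    have hhy : |h y| ≤ A * w := by
      have h1 : |h y - h x₀| ≤ ‖y - x₀‖ := by
        have := hh.dist_le_mul y x₀
        rwa [Real.dist_eq, dist_eq_norm, NNReal.coe_one, one_mul] at this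
      have h2 : |h y| ≤ |h y - h x₀| + |h x₀| := by
        have := abs_add_le (h y - h x₀) (h x₀); simpa using this
      simp only [A, hw]
      nlinarith [abs_nonneg (h x₀), norm_nonneg (y - x₀)]
    have hg : gk t (y - x) * u ^ (k + (d + 2)) ≤ D := by rw [mul_comm]; exact hD _
    have key : gk t (y - x) * ‖p (y - x)‖ * w ^ (d + 2) ≤ C * D * 2 ^ (d + 2) := by
      calc gk t (y - x) * ‖p (y - x)‖ * w ^ (d + 2)
          ≤ gk t (y - x) * (C * u ^ k) * (2 * u) ^ (d + 2) := by
            have := gk_pos t (y - x)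
            gcongr
            exact hC _
        _ = C * (gk t (y - x) * u ^ (k + (d + 2))) * 2 ^ (d + 2) := by
            rw [mul_pow, pow_add]; ring
        _ ≤ _ := by gcongr
    have hpow : w ^ (-((d : ℝ) + 1)) = (w ^ (d + 1))⁻¹ := by
      rw [Real.rpow_neg (by positivity)]; congr 1; exact_mod_cast Real.rpow_natCast w (d + 1)
    rw [norm_smul, norm_smul, Real.norm_eq_abs, Real.norm_of_nonneg (gk_pos _ _).le]
    beta_reduce
    rw [hpow, ← div_eq_mul_inv, le_div_iff₀ (by positivity)]
    have hnn : 0 ≤ gk t (y - x) * ‖p (y - x)‖ := by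
      have := gk_pos t (y - x); positivity
    calc |h y| * (gk t (y - x) * ‖p (y - x)‖) * w ^ (d + 1)
        ≤ (A * w) * (gk t (y - x) * ‖p (y - x)‖) * w ^ (d + 1) := by gcongr
      _ = A * (gk t (y - x) * ‖p (y - x)‖ * w ^ (d + 2)) := by ring
      _ ≤ _ := by gcongr

lemma integrable_T {t : ℝ} (ht : 0 < t) {p : VV → V} (hp : p.HasTemperateGrowth)
    {h : VV → ℝ} (hh : LipschitzWith 1 h) (x : VV) :
    Integrable (fun y => h y • gk t (y - x) • p (y - x)) := by
  obtain ⟨b, hb, hb'⟩ := dom ht hp hh x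
  refine hb.mono' ?_ (.of_forall fun y => hb' y x (by simp))
  have h1 := hh.continuous
  have h2 := gk_continuous (d := d) t
  have h3 := hp.1.continuous
  have : Continuous (fun y => h y • gk t (y - x) • p (y - x)) := by fun_prop
  exact this.aestronglyMeasurable

/-- convolution operator -/
noncomputable def T (t : ℝ) (h : VV → ℝ) (p : VV → ℝ) (x : VV) : ℝ :=
  ∫ y, h y • gk t (y - x) • p (y - x)

/-- full derivative symbol -/
noncomputable def Dp (t : ℝ) (p : VV → ℝ) (z : VV) : VV →L[ℝ] ℝ :=
  (p z * t⁻¹) • innerSL ℝ z - fderiv ℝ p z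

lemma temperate_fderiv {p : VV → ℝ} (hp : p.HasTemperateGrowth) :
    (fderiv ℝ p).HasTemperateGrowth := by
  refine ⟨(contDiff_infty_iff_fderiv.1 hp.1).2, fun n => ?_⟩
  obtain ⟨k, C, hC⟩ := hp.2 (n + 1)
  refine ⟨k, C, fun x => ?_⟩
  rw [norm_iteratedFDeriv_fderiv]
  exact hC x

lemma temperate_Dp {t : ℝ} {p : VV → ℝ} (hp : p.HasTemperateGrowth) :
    (Dp t p).HasTemperateGrowth := by
  have h1 := temperate_fderiv hp
  have h2 : (fun z : VV => innerSL ℝ z).HasTemperateGrowth :=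
    (innerSL ℝ (E := VV)).hasTemperateGrowth
  unfold Dp
  exact ((hp.mul (.const t⁻¹)).smul h2).sub h1

lemma temperate_Dp_apply {t : ℝ} {p : VV → ℝ} (hp : p.HasTemperateGrowth) (v : VV) :
    (fun z => Dp t p z v).HasTemperateGrowth := by
  have := (ContinuousLinearMap.apply ℝ ℝ v : (VV →L[ℝ] ℝ) →L[ℝ] ℝ).hasTemperateGrowth.comp
    (temperate_Dp (t := t) hp)
  exact this

lemma hasFDerivAt_T {t : ℝ} (ht : 0 < t) {p : VV → ℝ} (hp : p.HasTemperateGrowth)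
    {h : VV → ℝ} (hh : LipschitzWith 1 h) (x : VV) :
    HasFDerivAt (T t h p) (∫ y, h y • gk t (y - x) • Dp t p (y - x)) x := by
  obtain ⟨b, hb, hb'⟩ := dom ht (temperate_Dp (t := t) hp) hh x
  refine hasFDerivAt_integral_of_dominated_of_fderiv_le
    (F := fun x y => h y • gk t (y - x) • p (y - x))
    (F' := fun x y => h y • gk t (y - x) • Dp t p (y - x))
    (Metric.ball_mem_nhds x one_pos)
    (.of_forall fun x => (integrable_T ht hp hh x).aestronglyMeasurable)
    (integrable_T ht hp hh x) (integrable_T ht (temperate_Dp hp) hh x).aestronglyMeasurable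
    (.of_forall hb') hb (.of_forall fun y x _ => ?_)
  have hpd : HasFDerivAt p (fderiv ℝ p (y - x)) (y - x) :=
    (hp.1.differentiable (by simp) _).hasFDerivAt
  have h1 := (gk_hasFDerivAt (t := t) (y - x)).mul hpd
  have h2 : HasFDerivAt (fun x : VV => y - x) (-ContinuousLinearMap.id ℝ VV) x :=
    (hasFDerivAt_id x).const_sub y
  have h3 := (h1.comp x h2).const_mul (h y)
  refine h3.congr_fderiv ?_
  ext v
  simp [Dp]
  ring

lemma fderiv_T {t : ℝ} (ht : 0 < t) {p : VV → ℝ} (hp : p.HasTemperateGrowth)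
    {h : VV → ℝ} (hh : LipschitzWith 1 h) (v : VV) :
    (fun x => fderiv ℝ (T t h p) x v) = T t h (fun z => Dp t p z v) := by
  funext x
  rw [(hasFDerivAt_T ht hp hh x).fderiv,
    ContinuousLinearMap.integral_apply (integrable_T ht (temperate_Dp hp) hh x)]
  rfl

lemma contDiff_T {t : ℝ} (ht : 0 < t) {h : VV → ℝ} (hh : LipschitzWith 1 h) (n : ℕ) :
    ∀ {p : VV → ℝ}, p.HasTemperateGrowth → ContDiff ℝ n (T t h p) := by
  induction n with
  | zero =>
    intro p hp
    have : Differentiable ℝ (T t h p) := fun x => (hasFDerivAt_T ht hp hh x).differentiableAt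
    simpa using this.continuous
  | succ n ih =>
    intro p hp
    rw [Nat.cast_succ, contDiff_succ_iff_fderiv_apply]
    refine ⟨fun x => (hasFDerivAt_T ht hp hh x).differentiableAt, by simp, fun v => ?_⟩
    rw [fderiv_T ht hp hh]
    exact ih (temperate_Dp_apply hp v)

lemma T_shift (t : ℝ) (h p : VV → ℝ) (x : VV) :
    T t h p x = ∫ z, h (z + x) • gk t z • p z := by
  unfold T
  rw [← integral_add_right_eq_self _ x]
  simp

/-- second order symbol -/
noncomputable def Q (t : ℝ) (v₁ v₂ : VV) (z : VV) : ℝ :=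
  inner ℝ z v₁ * inner ℝ z v₂ / t ^ 2 - inner ℝ v₁ v₂ / t

lemma Dp_one (t : ℝ) (v : VV) :
    (fun z => Dp t (fun _ : VV => (1 : ℝ)) z v) = fun z => t⁻¹ * inner ℝ z v := by
  funext z
  simp [Dp]

lemma Dp_Dp_one (t : ℝ) (v₁ v₂ : VV) :
    (fun z => Dp t (fun z => Dp t (fun _ : VV => (1 : ℝ)) z v₁) z v₂) = Q t v₁ v₂ := by
  rw [Dp_one]
  funext z
  have : HasFDerivAt (fun z : VV => t⁻¹ * inner ℝ z v₁) (t⁻¹ • innerSL ℝ v₁) z := by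
    have h := (t⁻¹ • innerSL ℝ v₁).hasFDerivAt (x := z)
    refine h.congr_of_eventuallyEq (.of_forall fun z => ?_)
    simp [real_inner_comm]
  simp only [Dp, this.fderiv, Q]
  simp
  ring

lemma temperate_one : (fun _ : VV => (1 : ℝ)).HasTemperateGrowth := .const 1

lemma temperate_Q (t : ℝ) (v₁ v₂ : VV) : (Q t v₁ v₂).HasTemperateGrowth := by
  rw [← Dp_Dp_one]
  exact temperate_Dp_apply (temperate_Dp_apply temperate_one v₁) v₂

lemma second_T {t : ℝ} (ht : 0 < t) {h : VV → ℝ} (hh : LipschitzWith 1 h) (v₁ v₂ : VV) :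
    (fun y => fderiv ℝ (fun w => fderiv ℝ (T t h fun _ => 1) w v₁) y v₂) =
      T t h (Q t v₁ v₂) := by
  rw [fderiv_T ht temperate_one hh, fderiv_T ht (temperate_Dp_apply temperate_one v₁) hh, Dp_Dp_one]

lemma lip_one : LipschitzWith 1 (fun _ : VV => (1 : ℝ)) := (LipschitzWith.const 1).weaken (by simp)

lemma integral_Q {t : ℝ} (ht : 0 < t) (v₁ v₂ : VV) : ∫ z, gk t z * Q t v₁ v₂ z = 0 := by
  have h1 := congrFun (second_T ht lip_one v₁ v₂) 0
  rw [T_shift] at h1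
  have h2 : (T t (fun _ : VV => (1 : ℝ)) fun _ => 1) = fun _ => ∫ z : VV, gk t z := by
    funext x; rw [T_shift]; simp
  rw [h2] at h1
  simp at h1
  exact h1.symm

lemma integrable_gk_mul {t : ℝ} (ht : 0 < t) {p : VV → ℝ} (hp : p.HasTemperateGrowth) :
    Integrable (fun z => gk t z * p z) := by
  have := integrable_T ht hp lip_one 0
  simpa using this

lemma temperate_inner_mul (v₁ v₂ : VV) :
    (fun z : VV => inner ℝ z v₁ * inner ℝ z v₂).HasTemperateGrowth := by
  fun_prop

lemma second_moment {t : ℝ} (ht : 0 < t) (v : VV) :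
    ∫ z, gk t z * (inner ℝ z v * inner ℝ z v) = t * ‖v‖ ^ 2 * ∫ z : VV, gk t z := by
  have h0 := integral_Q ht v v
  have i1 := integrable_gk_mul ht (temperate_inner_mul v v)
  have i2 : Integrable (fun z : VV => gk t z) := by simpa using integrable_gk_mul ht temperate_one
  have e : (fun z => gk t z * Q t v v z) = fun z =>
      (t ^ 2)⁻¹ * (gk t z * (inner ℝ z v * inner ℝ z v)) - (‖v‖ ^ 2 / t) * gk t z := by
    funext z; simp only [Q, real_inner_self_eq_norm_sq]; ring
  rw [e, integral_sub (i1.const_mul _) (i2.const_mul _), integral_const_mul,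
    integral_const_mul] at h0
  simp only [← pow_two] at h0 ⊢
  field_simp at h0
  linarith

lemma integral_abs_Q {t : ℝ} (ht : 0 < t) (v₁ v₂ : VV) :
    ∫ z, gk t z * |Q t v₁ v₂ z| ≤ 2 / t * (‖v₁‖ * ‖v₂‖) * ∫ z : VV, gk t z := by
  rcases eq_or_ne v₁ 0 with rfl | hv₁
  · simp [Q]
  rcases eq_or_ne v₂ 0 with rfl | hv₂
  · simp [Q]
  have n1 : 0 < ‖v₁‖ := norm_pos_iff.2 hv₁
  have n2 : 0 < ‖v₂‖ := norm_pos_iff.2 hv₂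
  set s := ‖v₂‖ / ‖v₁‖ with hs
  have hs0 : 0 < s := by positivity
  have i0 := integrable_gk_mul ht (temperate_Q t v₁ v₂)
  have i1 := integrable_gk_mul ht (temperate_inner_mul v₁ v₁)
  have i2 := integrable_gk_mul ht (temperate_inner_mul v₂ v₂)
  have i3 : Integrable (fun z : VV => gk t z) := by simpa using integrable_gk_mul ht temperate_one
  have i0' : Integrable (fun z => gk t z * |Q t v₁ v₂ z|) := by
    refine i0.abs.congr (.of_forall fun z => ?_)
    simp [abs_mul, abs_of_pos (gk_pos t z)]
  have bound : ∀ z, gk t z * |Q t v₁ v₂ z| ≤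
      (s / (2 * t ^ 2)) * (gk t z * (inner ℝ z v₁ * inner ℝ z v₁)) +
      (s⁻¹ / (2 * t ^ 2)) * (gk t z * (inner ℝ z v₂ * inner ℝ z v₂)) +
      (‖v₁‖ * ‖v₂‖ / t) * gk t z := by
    intro z
    set a : ℝ := inner ℝ z v₁
    set b : ℝ := inner ℝ z v₂
    have h1 : |a * b| ≤ (s * a ^ 2 + s⁻¹ * b ^ 2) / 2 := by
      have e : (s * a ^ 2 + s⁻¹ * b ^ 2) / 2 = (s ^ 2 * |a| ^ 2 + |b| ^ 2) / (2 * s) := by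
        rw [sq_abs, sq_abs]; field_simp
      rw [e, le_div_iff₀ (by positivity), abs_mul]
      nlinarith [sq_nonneg (s * |a| - |b|)]
    have h2 : |(inner ℝ v₁ v₂ : ℝ)| ≤ ‖v₁‖ * ‖v₂‖ := abs_real_inner_le_norm _ _
    have h3 : |Q t v₁ v₂ z| ≤ (s * a ^ 2 + s⁻¹ * b ^ 2) / 2 / t ^ 2 + ‖v₁‖ * ‖v₂‖ / t := by
      unfold Q
      refine (abs_sub _ _).trans ?_
      rw [abs_div, abs_div, abs_of_pos ht, abs_of_pos (by positivity : 0 < t ^ 2)]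
      gcongr
    calc _ ≤ gk t z * ((s * a ^ 2 + s⁻¹ * b ^ 2) / 2 / t ^ 2 + ‖v₁‖ * ‖v₂‖ / t) :=
          mul_le_mul_of_nonneg_left h3 (gk_pos t z).le
      _ = _ := by ring
  have j1 := i1.const_mul (s / (2 * t ^ 2))
  have j2 := i2.const_mul (s⁻¹ / (2 * t ^ 2))
  have j3 := i3.const_mul (‖v₁‖ * ‖v₂‖ / t)
  refine (integral_mono i0' ((j1.add j2).add j3) bound).trans (le_of_eq ?_)
  rw [integral_add' (j1.add j2) j3, integral_add' j1 j2, integral_const_mul, integral_const_mul, integral_const_mul,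
    second_moment ht, second_moment ht, hs]
  field_simp
  ring

lemma lipschitz_T_Q {t : ℝ} (ht : 0 < t) {h : VV → ℝ} (hh : LipschitzWith 1 h) (v₁ v₂ x x' : VV) :
    |T t h (Q t v₁ v₂) x - T t h (Q t v₁ v₂) x'| ≤
      2 / t * (‖v₁‖ * ‖v₂‖) * (∫ z : VV, gk t z) * ‖x - x'‖ := by
  have hi : ∀ x, Integrable (fun z => h (z + x) • gk t z • Q t v₁ v₂ z) := fun x => by
    have := (integrable_T ht (temperate_Q t v₁ v₂) hh x).comp_add_right x
    simpa using this
  have i0 := integrable_gk_mul ht (temperate_Q t v₁ v₂)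
  have i0' : Integrable (fun z => gk t z * |Q t v₁ v₂ z|) := by
    refine i0.abs.congr (.of_forall fun z => ?_)
    simp [abs_mul, abs_of_pos (gk_pos t z)]
  rw [T_shift, T_shift, ← integral_sub (hi x) (hi x'), ← Real.norm_eq_abs]
  calc _ ≤ ∫ z, (gk t z * |Q t v₁ v₂ z|) * ‖x - x'‖ := by
        refine norm_integral_le_of_norm_le (i0'.mul_const _) (.of_forall fun z => ?_)
        have h1 : |h (z + x) - h (z + x')| ≤ ‖x - x'‖ := by
          have := hh.dist_le_mul (z + x) (z + x')
          rwa [Real.dist_eq, dist_eq_norm, NNReal.coe_one, one_mul, add_sub_add_left_eq_sub] at this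
        rw [← sub_smul, norm_smul, norm_smul, Real.norm_eq_abs, Real.norm_eq_abs, Real.norm_eq_abs,
          abs_of_pos (gk_pos t z), mul_comm]
        have := gk_pos t z
        gcongr
    _ = (∫ z, gk t z * |Q t v₁ v₂ z|) * ‖x - x'‖ := integral_mul_const _ _
    _ ≤ _ := by gcongr; exact integral_abs_Q ht v₁ v₂

lemma normalization {t : ℝ} (ht : 0 < t) :
    (2 * Real.pi * t) ^ (-(d : ℝ) / 2) * ∫ z : VV, gk t z = 1 := by
  have h := GaussianFourier.integral_rexp_neg_mul_sq_norm (V := VV) (b := 1 / (2 * t)) (by positivity)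
  have e : (fun z : VV => gk t z) = fun z => Real.exp (-(1 / (2 * t)) * ‖z‖ ^ 2) := by
    funext z; unfold gk; congr 1; ring
  have hp := Real.pi_pos
  rw [e, h, finrank_euclideanSpace_fin, show Real.pi / (1 / (2 * t)) = 2 * Real.pi * t by
    field_simp, ← Real.rpow_add (by positivity)]
  rw [show -(d : ℝ) / 2 + d / 2 = 0 by ring, Real.rpow_zero]

lemma gaussSmooth_eq (t : ℝ) (h : VV → ℝ) :
    gaussSmooth d t h = fun x => (2 * Real.pi * t) ^ (-(d : ℝ) / 2) * T t h (fun _ => 1) x := by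
  funext x
  simp only [gaussSmooth, T, gk]
  congr 2
  funext y
  simp [mul_comm]

end GaussAux

open GaussAux in
/-- Third-derivative bound for the Gaussian semigroup acting on Lipschitz functions
(proof of Lemma 4.4, Appendix D): for 1-Lipschitz `h`, the Gaussian smoothing `P_t h`
is three times continuously differentiable and
`|∇_{v₃}∇_{v₂}∇_{v₁}(P_t h)(x)| ≤ (2/t)|v₁||v₂||v₃|`. -/
theorem gaussSmooth_third_derivative_bound
    {d : ℕ} (hd : 1 ≤ d) {t : ℝ} (ht : 0 < t)
    (h : EuclideanSpace ℝ (Fin d) → ℝ) (hLip : LipschitzWith 1 h) :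
    ContDiff ℝ 3 (gaussSmooth d t h) ∧
      ∀ x v₁ v₂ v₃ : EuclideanSpace ℝ (Fin d),
        |fderiv ℝ (fun y =>
            fderiv ℝ (fun w => fderiv ℝ (gaussSmooth d t h) w v₁) y v₂) x v₃| ≤
          2 / t * (‖v₁‖ * ‖v₂‖ * ‖v₃‖) := by
  rw [gaussSmooth_eq]
  set c := (2 * Real.pi * t) ^ (-(d : ℝ) / 2) with hc
  have hc0 : 0 ≤ c := by have := Real.pi_pos; positivity
  refine ⟨contDiff_const.mul (contDiff_T ht hLip 3 temperate_one), fun x v₁ v₂ v₃ => ?_⟩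
  have hdiff : ∀ {p : EuclideanSpace ℝ (Fin d) → ℝ}, p.HasTemperateGrowth →
      Differentiable ℝ (T t h p) := fun hp x => (hasFDerivAt_T ht hp hLip x).differentiableAt
  have e1 : (fun y => fderiv ℝ (fun w => fderiv ℝ (fun x => c * T t h (fun _ => 1) x) w v₁) y v₂)
      = fun y => c * T t h (Q t v₁ v₂) y := by
    have a1 : (fun w => fderiv ℝ (fun x => c * T t h (fun _ => 1) x) w v₁) =
        fun w => c * fderiv ℝ (T t h fun _ => 1) w v₁ := by
      funext w
      rw [fderiv_const_mul (hdiff temperate_one w)]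
      rfl
    rw [a1, ← second_T ht hLip]
    funext y
    rw [fderiv_const_mul]
    · rfl
    · rw [fderiv_T ht temperate_one hLip]
      exact hdiff (temperate_Dp_apply temperate_one v₁) y
  rw [e1]
  have hL : LipschitzWith (Real.toNNReal (2 / t * (‖v₁‖ * ‖v₂‖)))
      (fun y => c * T t h (Q t v₁ v₂) y) := by
    refine LipschitzWith.of_dist_le_mul fun x y => ?_
    rw [Real.coe_toNNReal _ (by positivity), Real.dist_eq, dist_eq_norm, ← mul_sub, abs_mul,
      abs_of_nonneg hc0]
    calc _ ≤ c * (2 / t * (‖v₁‖ * ‖v₂‖) * (∫ z, gk t z) * ‖x - y‖) := by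
          gcongr; exact lipschitz_T_Q ht hLip v₁ v₂ x y
      _ = (c * ∫ z : EuclideanSpace ℝ (Fin d), gk t z) * (2 / t * (‖v₁‖ * ‖v₂‖) * ‖x - y‖) := by
          ring
      _ = _ := by rw [hc, normalization ht, one_mul]
  have := norm_fderiv_le_of_lipschitz ℝ hL (x₀ := x)
  rw [Real.coe_toNNReal _ (by positivity)] at this
  rw [← Real.norm_eq_abs]
  calc _ ≤ _ := ContinuousLinearMap.le_of_opNorm_le _ this v₃
    _ = _ := by ring
end

section
/- Let d ≥ 1, t > 0, and let h : ℝ^d → ℝ be 1-Lipschitz. Define P_t h(x) = E[h(x + B_t)] where B_t is a centered Gaussian vector with covariance t I_d. Then P_t h is twice differentiable and for all x, v₁, v₂ ∈ ℝ^d, ∇_{v₂} ∇_{v₁} (P_t h)(x) = E[ h(x + B_t) ( ⟨B_t/t, v₂⟩ ⟨B_t/t, v₁⟩ − (1/t) ⟨v₂, v₁⟩ ) ]. -/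
open MeasureTheory
open scoped RealInnerProductSpace

/-- The density of the Gaussian law `N(0, t I_d)` on `ℝ^d`. -/
noncomputable def gaussDensity (d : ℕ) (t : ℝ) (z : EuclideanSpace ℝ (Fin d)) : ℝ :=
  (2 * Real.pi * t) ^ (-(d : ℝ) / 2) * Real.exp (-‖z‖ ^ 2 / (2 * t))

/-- `P_t h(x) = E[h(x + B_t)]` where `B_t ~ N(0, t I_d)`, written as an integral
against the Gaussian density. -/
noncomputable def gaussSemigroup (d : ℕ) (t : ℝ) (h : EuclideanSpace ℝ (Fin d) → ℝ)
    (x : EuclideanSpace ℝ (Fin d)) : ℝ :=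
  ∫ z, gaussDensity d t z * h (x + z)

set_option maxSynthPendingDepth 3

section helpers

variable {E : Type*} [NormedAddCommGroup E] [NormedSpace ℝ E]
  {G : Type*} [NormedAddCommGroup G] [NormedSpace ℝ G]

theorem aux_bound (n : ℕ) (h : E → ℝ) (hLip : LipschitzWith 1 h)
    (k : E → G) (C : ℝ) (hk : ∀ z, ‖k z‖ * (1 + ‖z‖) ^ (n + 2) ≤ C)
    (x₀ x y : E) (hx : ‖x - x₀‖ ≤ 1) :
    ‖h y • k (y - x)‖ ≤ ((|h x₀| + 1) * (2 ^ (n + 2) * C)) * ((1 + ‖y - x₀‖) ^ (n + 1))⁻¹ := by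
  have hpos : 0 < 1 + ‖y - x₀‖ := by positivity
  rw [← div_eq_mul_inv, le_div_iff₀ (by positivity), norm_smul, Real.norm_eq_abs]
  have h1 : |h y| ≤ (|h x₀| + 1) * (1 + ‖y - x₀‖) := by
    have := hLip.dist_le_mul y x₀
    rw [Real.dist_eq, dist_eq_norm] at this
    simp only [NNReal.coe_one, one_mul] at this
    have h2 : |h y| ≤ |h y - h x₀| + |h x₀| := by
      have := abs_add_le (h y - h x₀) (h x₀)
      simpa using this
    nlinarith [abs_nonneg (h x₀), norm_nonneg (y - x₀)]
  have h2 : 1 + ‖y - x₀‖ ≤ 2 * (1 + ‖y - x‖) := by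
    have : ‖y - x₀‖ ≤ ‖y - x‖ + ‖x - x₀‖ := by
      have := norm_add_le (y - x) (x - x₀)
      simpa using this
    linarith [norm_nonneg (y - x)]
  have h3 : (1 + ‖y - x₀‖) ^ (n + 2) ≤ 2 ^ (n + 2) * (1 + ‖y - x‖) ^ (n + 2) := by
    rw [← mul_pow]
    exact pow_le_pow_left₀ hpos.le h2 _
  calc |h y| * ‖k (y - x)‖ * (1 + ‖y - x₀‖) ^ (n + 1)
      ≤ ((|h x₀| + 1) * (1 + ‖y - x₀‖)) * ‖k (y - x)‖ * (1 + ‖y - x₀‖) ^ (n + 1) := by gcongr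
    _ = (|h x₀| + 1) * (‖k (y - x)‖ * (1 + ‖y - x₀‖) ^ (n + 2)) := by ring
    _ ≤ (|h x₀| + 1) * (‖k (y - x)‖ * (2 ^ (n + 2) * (1 + ‖y - x‖) ^ (n + 2))) := by gcongr
    _ = (|h x₀| + 1) * (2 ^ (n + 2) * (‖k (y - x)‖ * (1 + ‖y - x‖) ^ (n + 2))) := by ring
    _ ≤ _ := by
      have := hk (y - x)
      gcongr

variable [FiniteDimensional ℝ E] [MeasurableSpace E] [BorelSpace E]
  (μ : Measure E) [μ.IsAddHaarMeasure]

theorem aux_int (x₀ : E) (D : ℝ) :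
    Integrable (fun y => D * ((1 + ‖y - x₀‖) ^ (Module.finrank ℝ E + 1))⁻¹) μ := by
  refine Integrable.const_mul ?_ D
  have h0 : Integrable (fun y : E => (1 + ‖y‖) ^ (-((Module.finrank ℝ E + 1 : ℕ) : ℝ))) μ :=
    integrable_one_add_norm (by push_cast; linarith)
  have h1 := h0.comp_sub_right x₀
  refine h1.congr (Filter.Eventually.of_forall fun y => ?_)
  simp only []
  rw [Real.rpow_neg (by positivity), Real.rpow_natCast]

theorem aux_cont (h : E → ℝ) (hLip : LipschitzWith 1 h)
    (k : E → G) (hkc : Continuous k) (x : E) :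
    Continuous (fun y => h y • k (y - x)) :=
  hLip.continuous.smul (hkc.comp (by fun_prop))

theorem aux_integrable (h : E → ℝ) (hLip : LipschitzWith 1 h)
    (k : E → G) (hkc : Continuous k) (C : ℝ)
    (hk : ∀ z, ‖k z‖ * (1 + ‖z‖) ^ (Module.finrank ℝ E + 2) ≤ C) (x : E) :
    Integrable (fun y => h y • k (y - x)) μ := by
  refine (aux_int μ x _).mono' (aux_cont h hLip k hkc x).aestronglyMeasurable
    (Filter.Eventually.of_forall fun y => aux_bound _ h hLip k C hk x x y (by simp))

theorem aux_continuous (h : E → ℝ) (hLip : LipschitzWith 1 h)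
    (k : E → G) (hkc : Continuous k) (C : ℝ)
    (hk : ∀ z, ‖k z‖ * (1 + ‖z‖) ^ (Module.finrank ℝ E + 2) ≤ C) :
    Continuous (fun x => ∫ y, h y • k (y - x) ∂μ) := by
  refine continuous_iff_continuousAt.2 fun x₀ => ?_
  refine continuousAt_of_dominated
    (Filter.Eventually.of_forall fun x => (aux_cont h hLip k hkc x).aestronglyMeasurable)
    ?_ (aux_int μ x₀ ((|h x₀| + 1) * (2 ^ (Module.finrank ℝ E + 2) * C))) (Filter.Eventually.of_forall fun y => ?_)
  · filter_upwards [Metric.ball_mem_nhds x₀ one_pos] with x hx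
    refine Filter.Eventually.of_forall fun y => aux_bound _ h hLip k C hk x₀ x y ?_
    rw [mem_ball_iff_norm] at hx
    exact hx.le
  · exact (continuous_const.smul (hkc.comp (by fun_prop))).continuousAt

theorem aux_deriv (h : E → ℝ) (hLip : LipschitzWith 1 h)
    (k : E → G) (k' : E → E →L[ℝ] G) (hk' : ∀ z, HasFDerivAt k (k' z) z)
    (hkc : Continuous k') (C : ℝ)
    (hb : ∀ z, ‖k z‖ * (1 + ‖z‖) ^ (Module.finrank ℝ E + 2) ≤ C)
    (hb' : ∀ z, ‖k' z‖ * (1 + ‖z‖) ^ (Module.finrank ℝ E + 2) ≤ C) (x₀ : E) :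
    HasFDerivAt (fun x => ∫ y, h y • k (y - x) ∂μ) (∫ y, h y • (fun z => -k' z) (y - x₀) ∂μ) x₀ := by
  have hk : Continuous k := continuous_iff_continuousAt.2 fun z => (hk' z).continuousAt
  refine hasFDerivAt_integral_of_dominated_of_fderiv_le
    (F' := fun x y => h y • (fun z => -k' z) (y - x)) (Metric.ball_mem_nhds x₀ one_pos)
    (Filter.Eventually.of_forall fun x => (aux_cont h hLip k hk x).aestronglyMeasurable)
    (aux_integrable μ h hLip k hk C hb x₀)
    (aux_cont h hLip _ hkc.neg x₀).aestronglyMeasurable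
    (Filter.Eventually.of_forall fun y x hx => ?_) (aux_int μ x₀ ((|h x₀| + 1) * (2 ^ (Module.finrank ℝ E + 2) * C)))
    (Filter.Eventually.of_forall fun y x hx => ?_)
  · refine aux_bound _ h hLip (fun z => -k' z) C (by simpa using hb') x₀ x y ?_
    rw [mem_ball_iff_norm] at hx
    exact hx.le
  · have h1 : HasFDerivAt (fun x => k (y - x)) (-k' (y - x)) x := by
      have := (hk' (y - x)).comp x ((hasFDerivAt_id x).const_sub y)
      refine this.congr_fderiv ?_
      ext v; simp
    exact h1.const_smul (h y)

end helpers

theorem aux_exp {t : ℝ} (ht : 0 < t) (M : ℕ) (s : ℝ) (hs : 0 ≤ s) :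
    Real.exp (-s ^ 2 / (2 * t)) * (1 + s) ^ M ≤ Real.exp (M ^ 2 * t / 2) := by
  have h1 : (1 + s) ^ M ≤ Real.exp (M * s) := by
    rw [Real.exp_nat_mul]
    refine pow_le_pow_left₀ (by positivity) ?_ _
    linarith [Real.add_one_le_exp s]
  calc _ ≤ Real.exp (-s ^ 2 / (2 * t)) * Real.exp (M * s) := by gcongr
    _ = Real.exp (-s ^ 2 / (2 * t) + M * s) := by rw [Real.exp_add]
    _ ≤ _ := by
      refine Real.exp_le_exp.2 ?_
      have : M ^ 2 * t / 2 - (-s ^ 2 / (2 * t) + M * s) = (s - M * t) ^ 2 / (2 * t) := by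
        field_simp; ring
      have h2 : 0 ≤ (s - M * t) ^ 2 / (2 * t) := by positivity
      linarith

/-- first derivative of the density -/
noncomputable def gd1 (d : ℕ) (t : ℝ) (z : EuclideanSpace ℝ (Fin d)) :
    EuclideanSpace ℝ (Fin d) →L[ℝ] ℝ :=
  (-(1 / t) * gaussDensity d t z) • innerSL ℝ z

/-- the inner product as a bilinear map -/
noncomputable abbrev iSL (d : ℕ) :
    EuclideanSpace ℝ (Fin d) →L[ℝ] EuclideanSpace ℝ (Fin d) →L[ℝ] ℝ := innerSL ℝ

/-- second derivative of the density -/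
noncomputable def gd2 (d : ℕ) (t : ℝ) (z : EuclideanSpace ℝ (Fin d)) :
    EuclideanSpace ℝ (Fin d) →L[ℝ] EuclideanSpace ℝ (Fin d) →L[ℝ] ℝ :=
  (-(1 / t) * gaussDensity d t z) • iSL d +
    ((-(1 / t)) • gd1 d t z).smulRight (innerSL ℝ z)

theorem gd_deriv (d : ℕ) {t : ℝ} (ht : 0 < t) (z : EuclideanSpace ℝ (Fin d)) :
    HasFDerivAt (gaussDensity d t) (gd1 d t z) z := by
  have h1 := (hasFDerivAt_id (𝕜 := ℝ) z).norm_sq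
  have h2 := ((h1.const_mul (-(1 / (2 * t)))).exp).const_mul ((2 * Real.pi * t) ^ (-(d : ℝ) / 2))
  have h3 : gaussDensity d t = fun z => (2 * Real.pi * t) ^ (-(d : ℝ) / 2) *
      Real.exp (-(1 / (2 * t)) * ‖id z‖ ^ 2) := by
    ext z
    simp only [gaussDensity, id]
    congr 2
    ring
  rw [h3]
  refine h2.congr_fderiv ?_
  ext v
  simp only [gd1, h3]
  simp
  field_simp

theorem gd1_deriv (d : ℕ) {t : ℝ} (ht : 0 < t) (z : EuclideanSpace ℝ (Fin d)) :
    HasFDerivAt (gd1 d t) (gd2 d t z) z :=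
  ((gd_deriv d ht z).const_mul (-(1 / t))).smul (iSL d).hasFDerivAt

theorem gd_cont (d : ℕ) (t : ℝ) : Continuous (gaussDensity d t) := by
  unfold gaussDensity
  fun_prop

theorem gd1_cont (d : ℕ) (t : ℝ) : Continuous (gd1 d t) := by
  unfold gd1
  have := gd_cont d t
  fun_prop

theorem gd2_cont (d : ℕ) (t : ℝ) : Continuous (gd2 d t) := by
  have h0 := gd_cont d t
  have h1 := gd1_cont d t
  have h2 : gd2 d t = fun z => (-(1 / t) * gaussDensity d t z) • iSL d +
    ContinuousLinearMap.smulRightL ℝ _ _ ((-(1 / t)) • gd1 d t z) (innerSL ℝ z) := by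
    ext z v w
    simp [gd2]
    ring
  rw [h2]
  fun_prop

theorem gd_nonneg (d : ℕ) {t : ℝ} (ht : 0 < t) (z) : 0 ≤ gaussDensity d t z := by
  unfold gaussDensity
  positivity

theorem gd_bound (d : ℕ) {t : ℝ} (ht : 0 < t) (M : ℕ) (z : EuclideanSpace ℝ (Fin d)) :
    gaussDensity d t z * (1 + ‖z‖) ^ M ≤
      (2 * Real.pi * t) ^ (-(d : ℝ) / 2) * Real.exp (M ^ 2 * t / 2) := by
  unfold gaussDensity
  rw [mul_assoc]
  have := aux_exp ht M ‖z‖ (norm_nonneg z)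
  gcongr

theorem gd1_norm (d : ℕ) {t : ℝ} (ht : 0 < t) (z : EuclideanSpace ℝ (Fin d)) :
    ‖gd1 d t z‖ ≤ (1 / t) * (gaussDensity d t z * (1 + ‖z‖)) := by
  have h0 := gd_nonneg d ht z
  rw [gd1, norm_smul, innerSL_apply_norm, norm_mul, norm_neg, Real.norm_of_nonneg h0,
    Real.norm_of_nonneg (by positivity), mul_assoc]
  gcongr
  linarith

theorem gd2_norm (d : ℕ) {t : ℝ} (ht : 0 < t) (z : EuclideanSpace ℝ (Fin d)) :
    ‖gd2 d t z‖ ≤ (1 / t + 1 / t * (1 / t)) * (gaussDensity d t z * (1 + ‖z‖) ^ 2) := by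
  have h0 := gd_nonneg d ht z
  have h1 := gd1_norm d ht z
  have ht' : 0 < 1 / t := by positivity
  refine (norm_add_le _ _).trans ?_
  rw [add_mul]
  refine add_le_add ?_ ?_
  · rw [norm_smul, norm_mul, norm_neg, Real.norm_of_nonneg h0, Real.norm_of_nonneg ht'.le, mul_assoc]
    have := norm_innerSL_le ℝ (E := EuclideanSpace ℝ (Fin d))
    have h3 : 1 ≤ (1 + ‖z‖) ^ 2 := by nlinarith [norm_nonneg z]
    gcongr
    exact this.trans h3
  · rw [ContinuousLinearMap.norm_smulRight_apply, norm_smul, norm_neg, Real.norm_of_nonneg ht'.le,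
      innerSL_apply_norm]
    calc _ ≤ 1 / t * ((1 / t) * (gaussDensity d t z * (1 + ‖z‖))) * (1 + ‖z‖) := by
          gcongr
          linarith
      _ = _ := by ring

theorem gd_exists (d : ℕ) {t : ℝ} (ht : 0 < t) (N : ℕ) : ∃ C, ∀ z,
    ‖gaussDensity d t z‖ * (1 + ‖z‖) ^ N ≤ C ∧ ‖gd1 d t z‖ * (1 + ‖z‖) ^ N ≤ C ∧
      ‖gd2 d t z‖ * (1 + ‖z‖) ^ N ≤ C := by
  have ht' : 0 < 1 / t := by positivity
  set B : ℕ → ℝ := fun M => (2 * Real.pi * t) ^ (-(d : ℝ) / 2) * Real.exp (M ^ 2 * t / 2) with hB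
  refine ⟨max (B N) (max (1 / t * B (N + 1)) ((1 / t + 1 / t * (1 / t)) * B (N + 2))), fun z => ?_⟩
  have b0 := gd_bound d ht N z
  have b1 := gd_bound d ht (N + 1) z
  have b2 := gd_bound d ht (N + 2) z
  refine ⟨le_max_of_le_left ?_, le_max_of_le_right (le_max_of_le_left ?_),
    le_max_of_le_right (le_max_of_le_right ?_)⟩
  · rwa [Real.norm_of_nonneg (gd_nonneg d ht z)]
  · calc _ ≤ (1 / t) * (gaussDensity d t z * (1 + ‖z‖)) * (1 + ‖z‖) ^ N := by
          gcongr; exact gd1_norm d ht z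
      _ = (1 / t) * (gaussDensity d t z * (1 + ‖z‖) ^ (N + 1)) := by ring
      _ ≤ _ := by gcongr
  · calc _ ≤ (1 / t + 1 / t * (1 / t)) * (gaussDensity d t z * (1 + ‖z‖) ^ 2) * (1 + ‖z‖) ^ N := by
          gcongr; exact gd2_norm d ht z
      _ = (1 / t + 1 / t * (1 / t)) * (gaussDensity d t z * (1 + ‖z‖) ^ (N + 2)) := by ring
      _ ≤ _ := by gcongr

/-- Second-derivative Gaussian integration-by-parts formula (equation (condition2)):
for 1-Lipschitz `h`, `P_t h` is twice differentiable and
`∇_{v₂}∇_{v₁}(P_t h)(x) = E[h(x + B_t)(⟨B_t/t,v₂⟩⟨B_t/t,v₁⟩ − ⟨v₂,v₁⟩/t)]`. -/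
theorem gaussSemigroup_second_derivative_repr
    {d : ℕ} (hd : 1 ≤ d) {t : ℝ} (ht : 0 < t)
    (h : EuclideanSpace ℝ (Fin d) → ℝ) (hLip : LipschitzWith 1 h) :
    ContDiff ℝ 2 (gaussSemigroup d t h) ∧
      ∀ x v₁ v₂ : EuclideanSpace ℝ (Fin d),
        fderiv ℝ (fun y => fderiv ℝ (gaussSemigroup d t h) y v₁) x v₂ =
          ∫ z, gaussDensity d t z *
            (h (x + z) * (⟪z, v₂⟫ / t * (⟪z, v₁⟫ / t) - ⟪v₂, v₁⟫ / t)) := by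
  obtain ⟨C, hC⟩ := gd_exists d ht (Module.finrank ℝ (EuclideanSpace ℝ (Fin d)) + 2)
  have hP : gaussSemigroup d t h = fun x => ∫ y, h y • gaussDensity d t (y - x) := by
    ext x
    rw [gaussSemigroup, ← integral_add_left_eq_self (fun y => h y • gaussDensity d t (y - x)) x]
    refine integral_congr_ae (Filter.Eventually.of_forall fun z => ?_)
    simp [mul_comm]
  have D1 := aux_deriv volume h hLip _ _ (gd_deriv d ht) (gd1_cont d t) C
    (fun z => (hC z).1) (fun z => (hC z).2.1)
  have D2 := aux_deriv volume h hLip (fun z => -gd1 d t z) (fun z => -gd2 d t z)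
    (fun z => (gd1_deriv d ht z).neg) (gd2_cont d t).neg C
    (fun z => by simpa using (hC z).2.1) (fun z => by simpa using (hC z).2.2)
  have c2 : Continuous (fun z => - -gd2 d t z) := (gd2_cont d t).neg.neg
  have b2 : ∀ z, ‖- -gd2 d t z‖ * (1 + ‖z‖) ^
      (Module.finrank ℝ (EuclideanSpace ℝ (Fin d)) + 2) ≤ C :=
    fun z => by simpa using (hC z).2.2
  rw [← hP] at D1
  refine ⟨?_, fun x v₁ v₂ => ?_⟩
  · have : ContDiff ℝ ((1 : ℕ) + 1) (gaussSemigroup d t h) := by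
      refine contDiff_succ_iff_hasFDerivAt.2 ⟨_, ?_, D1⟩
      exact contDiff_one_iff_hasFDerivAt.2 ⟨_, aux_continuous volume h hLip _ c2 C b2, D2⟩
    exact (by norm_num : ((1 : ℕ) + 1 : WithTop ℕ∞) = 2) ▸ this
  · have e1 : (fun y => fderiv ℝ (gaussSemigroup d t h) y v₁) =
        fun y => (∫ w, h w • (fun z => -gd1 d t z) (w - y)) v₁ := by
      ext y
      rw [(D1 y).fderiv]
    have i2 := aux_integrable volume h hLip _ c2 C b2 x
    have e2 := ((D2 x).clm_apply (hasFDerivAt_const v₁ x)).fderiv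
    rw [e1, e2]
    simp only [ContinuousLinearMap.comp_zero, zero_add, ContinuousLinearMap.flip_apply]
    rw [ContinuousLinearMap.integral_apply i2,
      ContinuousLinearMap.integral_apply (i2.apply_continuousLinearMap v₂),
      ← integral_add_left_eq_self _ x]
    refine integral_congr_ae (Filter.Eventually.of_forall fun z => ?_)
    have hi : iSL d v₂ v₁ = ⟪v₂, v₁⟫ := rfl
    simp [gd2, gd1, hi]
    ring
end

section
/- Let d ≥ 1 and α ∈ (1, 2). Let V(𝕊^{d−1}) = 2π^{d/2}/Γ(d/2), and let Z̃ be a random vector in ℝ^d with density p(z) = α / (V(𝕊^{d−1}) |z|^{α+d}) for |z| > 1 and p(z) = 0 for |z| ≤ 1. Set V(y) = (1 + |y|²)^{1/2}, so ∇V(y) = y / V(y). Then for every y ∈ ℝ^d, every η ∈ (0, 1] and every r ≥ 0, | E[ ⟨ ∇V( (1 − η/α) y + r Z̃ ), Z̃ ⟩ ] | ≤ (2α√d / (2 − α)) r η^{(α−2)/α} + (α / (α − 1)) η^{(α−1)/α}. -/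
open MeasureTheory
open scoped RealInnerProductSpace

/-- Surface area of the unit sphere `𝕊^{d−1}`: `V(𝕊^{d−1}) = 2π^{d/2}/Γ(d/2)`. -/
noncomputable def sphereArea (d : ℕ) : ℝ :=
  2 * Real.pi ^ ((d : ℝ) / 2) / Real.Gamma ((d : ℝ) / 2)

/-- The Pareto density `p(z) = α/(V(𝕊^{d−1})|z|^{α+d})` for `|z| > 1`, `0` otherwise. -/
noncomputable def paretoDensity (d : ℕ) (α : ℝ) (z : EuclideanSpace ℝ (Fin d)) : ℝ :=
  if 1 < ‖z‖ then α / (sphereArea d * ‖z‖ ^ (α + (d : ℝ))) else 0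

/-- The gradient of `V`. -/
noncomputable def gradV {d : ℕ} (x : EuclideanSpace ℝ (Fin d)) : EuclideanSpace ℝ (Fin d) :=
  (Real.sqrt (1 + ‖x‖ ^ 2))⁻¹ • x

theorem sqrt_one_le {d : ℕ} (x : EuclideanSpace ℝ (Fin d)) : 1 ≤ Real.sqrt (1 + ‖x‖ ^ 2) := by
  rw [Real.one_le_sqrt]; nlinarith [sq_nonneg ‖x‖]

theorem norm_le_sqrt {d : ℕ} (x : EuclideanSpace ℝ (Fin d)) : ‖x‖ ≤ Real.sqrt (1 + ‖x‖ ^ 2) :=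
  Real.le_sqrt_of_sq_le (by linarith)

theorem norm_gradV_le {d : ℕ} (x : EuclideanSpace ℝ (Fin d)) : ‖gradV x‖ ≤ 1 := by
  have h1 := sqrt_one_le x
  have h2 := norm_le_sqrt x
  rw [gradV, norm_smul, norm_inv, Real.norm_of_nonneg (by linarith), inv_mul_le_one₀ (by linarith)]
  exact h2

theorem abs_sqrt_sub_le {d : ℕ} (a b : EuclideanSpace ℝ (Fin d)) :
    |Real.sqrt (1 + ‖b‖ ^ 2) - Real.sqrt (1 + ‖a‖ ^ 2)| ≤ ‖a - b‖ := by
  have ha1 := sqrt_one_le a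
  have hb1 := sqrt_one_le b
  have ha2 := norm_le_sqrt a
  have hb2 := norm_le_sqrt b
  have ha3 := Real.sq_sqrt (show 0 ≤ 1 + ‖a‖ ^ 2 by positivity)
  have hb3 := Real.sq_sqrt (show 0 ≤ 1 + ‖b‖ ^ 2 by positivity)
  set s := Real.sqrt (1 + ‖a‖ ^ 2)
  set t := Real.sqrt (1 + ‖b‖ ^ 2)
  have h : |t - s| * (t + s) = |‖b‖ - ‖a‖| * (‖b‖ + ‖a‖) := by
    rw [← abs_of_nonneg (show 0 ≤ t + s by linarith), ← abs_mul,
      ← abs_of_nonneg (show 0 ≤ ‖b‖ + ‖a‖ by positivity), ← abs_mul]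
    congr 1
    nlinarith
  have h4 : |‖b‖ - ‖a‖| ≤ ‖a - b‖ := by
    rw [norm_sub_rev]; exact abs_norm_sub_norm_le b a
  refine le_trans ?_ h4
  refine le_of_mul_le_mul_right (a := t + s) ?_ (by linarith)
  rw [h]
  gcongr

theorem gradV_lip {d : ℕ} (a b : EuclideanSpace ℝ (Fin d)) :
    ‖gradV a - gradV b‖ ≤ 2 * ‖a - b‖ := by
  have h := abs_sqrt_sub_le a b
  have hgb := norm_gradV_le b
  have ha1 := sqrt_one_le a
  have hb1 := sqrt_one_le b
  have key : gradV a - gradV b = (Real.sqrt (1 + ‖a‖ ^ 2))⁻¹ •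
      ((a - b) + (Real.sqrt (1 + ‖b‖ ^ 2) - Real.sqrt (1 + ‖a‖ ^ 2)) • gradV b) := by
    unfold gradV
    have ha : Real.sqrt (1 + ‖a‖ ^ 2) ≠ 0 := by positivity
    have hb : Real.sqrt (1 + ‖b‖ ^ 2) ≠ 0 := by positivity
    generalize Real.sqrt (1 + ‖a‖ ^ 2) = s at *
    generalize Real.sqrt (1 + ‖b‖ ^ 2) = t at *
    match_scalars <;> field_simp
    ring
  rw [key, norm_smul, norm_inv, Real.norm_of_nonneg (by linarith)]
  calc _ ≤ 1 * ‖(a - b) + (Real.sqrt (1 + ‖b‖ ^ 2) - Real.sqrt (1 + ‖a‖ ^ 2)) • gradV b‖ := by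
        gcongr
        exact inv_le_one_of_one_le₀ ha1
    _ ≤ ‖a - b‖ + ‖(Real.sqrt (1 + ‖b‖ ^ 2) - Real.sqrt (1 + ‖a‖ ^ 2)) • gradV b‖ := by
        rw [one_mul]; exact norm_add_le _ _
    _ ≤ ‖a - b‖ + ‖a - b‖ * 1 := by
        rw [norm_smul, Real.norm_eq_abs]
        gcongr
    _ = _ := by ring

/-- Radial profile of the dominating function. -/
noncomputable def radialDom (d : ℕ) (α R c t : ℝ) : ℝ :=
  (if 1 < t then α / (sphereArea d * t ^ (α + (d : ℝ))) else 0) * (if t ≤ R then c * t ^ 2 else t)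

theorem sphereArea_pos {d : ℕ} (hd : 1 ≤ d) : 0 < sphereArea d := by
  have : (0 : ℝ) < d := by exact_mod_cast hd
  have := Real.Gamma_pos_of_pos (show (0 : ℝ) < d / 2 by positivity)
  unfold sphereArea
  positivity

theorem sphereArea_eq {d : ℕ} (hd : 1 ≤ d) :
    (d : ℝ) * (volume : Measure (EuclideanSpace ℝ (Fin d))).real (Metric.ball 0 1) =
      sphereArea d := by
  have hd0 : (0 : ℝ) < d := by exact_mod_cast hd
  have : Nonempty (Fin d) := ⟨⟨0, hd⟩⟩
  have hG := Real.Gamma_pos_of_pos (show (0 : ℝ) < d / 2 by positivity)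
  have hG' := Real.Gamma_pos_of_pos (show (0 : ℝ) < d / 2 + 1 by positivity)
  rw [Measure.real, EuclideanSpace.volume_ball, Fintype.card_fin, ENNReal.ofReal_one, one_pow,
    one_mul, ENNReal.toReal_ofReal (by positivity), Real.Gamma_add_one (by positivity), sphereArea]
  have : Real.sqrt Real.pi ^ d = Real.pi ^ ((d : ℝ) / 2) := by
    rw [Real.sqrt_eq_rpow, ← Real.rpow_natCast, ← Real.rpow_mul Real.pi_pos.le]
    congr 1; ring
  rw [this]
  field_simp

theorem radialDom_eq {d : ℕ} (hd : 1 ≤ d) {α R c : ℝ} (hR : 1 ≤ R) {t : ℝ} (ht : 0 < t) :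
    t ^ (d - 1) • radialDom d α R c t = (α / sphereArea d) *
      ((Set.Ioc 1 R).indicator (fun t => c * t ^ (1 - α)) t +
        (Set.Ioi R).indicator (fun t => t ^ (-α)) t) := by
  have hS := sphereArea_pos hd
  have e1 : t ^ (d - 1) = t ^ ((d : ℝ) - 1) := by
    rw [← Real.rpow_natCast, Nat.cast_sub hd, Nat.cast_one]
  unfold radialDom
  have hp : t ^ (α + d) = t ^ α * t ^ (d : ℝ) := Real.rpow_add ht _ _
  have hα : 0 < t ^ α := by positivity
  have hdp : 0 < t ^ (d : ℝ) := by positivity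
  rw [e1, Real.rpow_sub_one ht.ne', hp, smul_eq_mul]
  by_cases h1 : 1 < t
  · by_cases h2 : t ≤ R
    · have h3 : ¬ R < t := not_lt.mpr h2
      simp only [h1, h2, h3, if_true, Set.indicator, Set.mem_Ioc, Set.mem_Ioi, and_self, if_false]
      rw [Real.rpow_sub ht, Real.rpow_one]
      field_simp
      ring
    · have h3 : R < t := not_le.mp h2
      simp only [h1, h2, h3, if_true, Set.indicator, Set.mem_Ioc, Set.mem_Ioi, and_false, if_false]
      rw [Real.rpow_neg ht.le]
      field_simp
      ring
  · have h3 : ¬ R < t := by linarith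
    simp [h1, h3]

theorem radialDom_integrable {d : ℕ} (hd : 1 ≤ d) {α R c : ℝ} (hα1 : 1 < α) (hα2 : α < 2)
    (hR : 1 ≤ R) :
    Integrable (fun z : EuclideanSpace ℝ (Fin d) => radialDom d α R c ‖z‖) ∧
    ∫ z : EuclideanSpace ℝ (Fin d), radialDom d α R c ‖z‖ =
      α * (c * ((R ^ (2 - α) - 1) / (2 - α)) + R ^ (1 - α) / (α - 1)) := by
  have hS := sphereArea_pos hd
  have : Nonempty (Fin d) := ⟨⟨0, hd⟩⟩
  have hEq : Set.EqOn (fun t => t ^ (d - 1) • radialDom d α R c t) (fun t => (α / sphereArea d) *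
      ((Set.Ioc 1 R).indicator (fun t => c * t ^ (1 - α)) t +
        (Set.Ioi R).indicator (fun t => t ^ (-α)) t)) (Set.Ioi 0) := fun t ht =>
    radialDom_eq hd hR ht
  have hi1' : IntervalIntegrable (fun t : ℝ => c * t ^ (1 - α)) volume 1 R :=
    (intervalIntegral.intervalIntegrable_rpow' (by linarith)).const_mul c
  have hi1 : IntegrableOn ((Set.Ioc 1 R).indicator (fun t => c * t ^ (1 - α))) (Set.Ioi 0) := by
    apply Integrable.integrableOn
    rw [integrable_indicator_iff measurableSet_Ioc]
    exact (intervalIntegrable_iff_integrableOn_Ioc_of_le hR).mp hi1'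
  have hi2 : IntegrableOn ((Set.Ioi R).indicator (fun t : ℝ => t ^ (-α))) (Set.Ioi 0) := by
    apply Integrable.integrableOn
    rw [integrable_indicator_iff measurableSet_Ioi]
    exact integrableOn_Ioi_rpow_of_lt (by linarith) (by linarith)
  have hs1 : Set.Ioi 0 ∩ Set.Ioc 1 R = Set.Ioc 1 R :=
    Set.inter_eq_right.mpr (fun t ht => Set.mem_Ioi.mpr (by linarith [ht.1]))
  have hs2 : Set.Ioi 0 ∩ Set.Ioi R = Set.Ioi R :=
    Set.inter_eq_right.mpr (fun t ht => Set.mem_Ioi.mpr (by linarith [Set.mem_Ioi.mp ht]))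
  constructor
  · rw [integrable_fun_norm_addHaar (μ := volume) (f := radialDom d α R c),
      finrank_euclideanSpace_fin, integrableOn_congr_fun hEq measurableSet_Ioi]
    exact (hi1.add hi2).const_mul _
  · rw [integral_fun_norm_addHaar (μ := volume) (f := radialDom d α R c),
      finrank_euclideanSpace_fin, setIntegral_congr_fun measurableSet_Ioi hEq,
      integral_const_mul, integral_add hi1 hi2, setIntegral_indicator measurableSet_Ioc,
      setIntegral_indicator measurableSet_Ioi,
      hs1, hs2,
      integral_Ioi_rpow_of_lt (by linarith) (by linarith),
      ← intervalIntegral.integral_of_le hR, intervalIntegral.integral_const_mul,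
      integral_rpow (Or.inl (by linarith)), nsmul_eq_mul, smul_eq_mul, ← mul_assoc,
      sphereArea_eq hd, Real.one_rpow, show 1 - α + 1 = 2 - α by ring,
      show -α + 1 = -(α - 1) by ring, show -(α - 1) = 1 - α by ring]
    have : 2 - α ≠ 0 := by linarith
    have : α - 1 ≠ 0 := by linarith
    have : 1 - α ≠ 0 := by linarith
    have e : -R ^ (1 - α) / (1 - α) = R ^ (1 - α) / (α - 1) := by
      rw [neg_div, ← div_neg]; congr 1; ring
    rw [e, ← mul_assoc]
    congr 1
    field_simp

theorem paretoDensity_nonneg {d : ℕ} (hd : 1 ≤ d) {α : ℝ} (hα : 0 < α)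
    (z : EuclideanSpace ℝ (Fin d)) : 0 ≤ paretoDensity d α z := by
  have hS := sphereArea_pos hd
  unfold paretoDensity
  split_ifs <;> positivity

theorem paretoDensity_measurable (d : ℕ) (α : ℝ) : Measurable (paretoDensity d α) := by
  unfold paretoDensity
  refine Measurable.ite (measurableSet_lt measurable_const measurable_norm) ?_ measurable_const
  fun_prop

theorem gradV_measurable (d : ℕ) : Measurable (gradV (d := d)) := by
  unfold gradV
  fun_prop

/-- Intermediate estimate from the proof of Lemma 4.5 (Appendix C): with
`V(y) = (1 + |y|²)^{1/2}` (so `∇V(y) = y/V(y)`) and `Z̃` a Pareto random vector,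
`|E⟨∇V((1 − η/α)y + rZ̃), Z̃⟩| ≤ (2α√d/(2−α)) r η^{(α−2)/α} + (α/(α−1)) η^{(α−1)/α}`.
The expectation is written as an integral against the Pareto density. -/
theorem pareto_gradient_pairing_bound
    {d : ℕ} (hd : 1 ≤ d) {α : ℝ} (hα1 : 1 < α) (hα2 : α < 2)
    (y : EuclideanSpace ℝ (Fin d)) (η r : ℝ) (hη : 0 < η) (hη1 : η ≤ 1) (hr : 0 ≤ r) :
    |∫ z, paretoDensity d α z *
        ⟪(Real.sqrt (1 + ‖(1 - η / α) • y + r • z‖ ^ 2))⁻¹ •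
          ((1 - η / α) • y + r • z), z⟫| ≤
      2 * α * Real.sqrt d / (2 - α) * r * η ^ ((α - 2) / α) +
        α / (α - 1) * η ^ ((α - 1) / α) := by
  have hα0 : 0 < α := by linarith
  change |∫ z, paretoDensity d α z * ⟪gradV ((1 - η / α) • y + r • z), z⟫| ≤ _
  generalize (1 - η / α) • y = w
  set R : ℝ := η ^ (-(1 / α)) with hRdef
  have hR : 1 ≤ R := Real.one_le_rpow_of_pos_of_le_one_of_nonpos hη hη1
    (by rw [neg_nonpos]; positivity)
  have hR2 : R ^ (2 - α) = η ^ ((α - 2) / α) := by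
    rw [hRdef, ← Real.rpow_mul hη.le]; congr 1; field_simp; ring
  have hR1 : R ^ (1 - α) = η ^ ((α - 1) / α) := by
    rw [hRdef, ← Real.rpow_mul hη.le]; congr 1; field_simp; ring
  obtain ⟨hI, hIeq⟩ := radialDom_integrable (c := 2 * r) hd hα1 hα2 hR
  obtain ⟨hI1, -⟩ := radialDom_integrable (c := 1) hd hα1 hα2 le_rfl
  have hdom : ∀ (z u : EuclideanSpace ℝ (Fin d)), ‖u‖ ≤ 1 →
      ‖paretoDensity d α z * ⟪u, z⟫‖ ≤ radialDom d α 1 1 ‖z‖ := by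
    intro z u hu
    rw [norm_mul, Real.norm_of_nonneg (paretoDensity_nonneg hd hα0 z)]
    by_cases h1 : 1 < ‖z‖
    · have : radialDom d α 1 1 ‖z‖ = paretoDensity d α z * ‖z‖ := by
        simp [radialDom, paretoDensity, h1, not_le.mpr h1]
      rw [this]
      have := paretoDensity_nonneg hd hα0 z
      gcongr
      calc _ ≤ ‖u‖ * ‖z‖ := norm_inner_le_norm u z
        _ ≤ 1 * ‖z‖ := by gcongr
        _ = _ := one_mul _
    · simp [radialDom, paretoDensity, h1]
  have hF : Integrable (fun z => paretoDensity d α z * ⟪gradV (w + r • z), z⟫) := by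
    refine hI1.mono' ?_ (Filter.Eventually.of_forall fun z => hdom z _ (norm_gradV_le _))
    refine Measurable.aestronglyMeasurable ?_
    have h1 := paretoDensity_measurable d α
    have h2 : Measurable fun z : EuclideanSpace ℝ (Fin d) => gradV (w + r • z) :=
      (gradV_measurable d).comp (by fun_prop)
    exact h1.mul (h2.inner measurable_id)
  let u : EuclideanSpace ℝ (Fin d) → EuclideanSpace ℝ (Fin d) :=
    fun z => if ‖z‖ ≤ R then gradV w else 0
  have hH : Integrable (fun z => paretoDensity d α z * ⟪u z, z⟫) := by
    refine hI1.mono' ?_ (Filter.Eventually.of_forall fun z => hdom z _ ?_)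
    · refine Measurable.aestronglyMeasurable ?_
      have h1 := paretoDensity_measurable d α
      have h2 : Measurable u :=
        Measurable.ite (measurableSet_le measurable_norm measurable_const) measurable_const
          measurable_const
      exact h1.mul (h2.inner measurable_id)
    · simp only [u]
      split_ifs
      · exact norm_gradV_le w
      · simp
  have hH0 : ∫ z, paretoDensity d α z * ⟪u z, z⟫ = 0 := by
    have h := integral_neg_eq_self (fun z => paretoDensity d α z * ⟪u z, z⟫) volume
    have h' : ∀ z, paretoDensity d α (-z) * ⟪u (-z), -z⟫ = -(paretoDensity d α z * ⟪u z, z⟫) := by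
      intro z
      simp [paretoDensity, u]
    simp only [h', integral_neg] at h
    linarith
  have hsub := integral_sub hF hH
  rw [hH0, sub_zero] at hsub
  rw [← hsub, ← Real.norm_eq_abs]
  refine (norm_integral_le_of_norm_le hI (Filter.Eventually.of_forall fun z => ?_)).trans ?_
  · rw [← mul_sub, ← inner_sub_left, norm_mul,
      Real.norm_of_nonneg (paretoDensity_nonneg hd hα0 z)]
    have hp := paretoDensity_nonneg hd hα0 z
    have : radialDom d α R (2 * r) ‖z‖ =
        paretoDensity d α z * (if ‖z‖ ≤ R then 2 * r * ‖z‖ ^ 2 else ‖z‖) := rfl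
    rw [this]
    refine mul_le_mul_of_nonneg_left ?_ hp
    refine (norm_inner_le_norm _ _).trans ?_
    simp only [u]
    split_ifs
    · have h := gradV_lip (w + r • z) w
      rw [add_sub_cancel_left, norm_smul, Real.norm_of_nonneg hr] at h
      calc _ ≤ (2 * (r * ‖z‖)) * ‖z‖ := by gcongr
        _ = _ := by ring
    · rw [sub_zero]
      calc _ ≤ 1 * ‖z‖ := by gcongr; exact norm_gradV_le _
        _ = _ := one_mul _
  · rw [hIeq, hR1, hR2]
    have hs : 1 ≤ Real.sqrt d := by
      rw [Real.one_le_sqrt]; exact_mod_cast hd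
    have hE : 0 ≤ η ^ ((α - 2) / α) := by positivity
    have h2 : 0 < 2 - α := by linarith
    have hmain : η ^ ((α - 2) / α) - 1 ≤ Real.sqrt d * η ^ ((α - 2) / α) := by nlinarith
    calc _ = 2 * α * r / (2 - α) * (η ^ ((α - 2) / α) - 1) +
          α / (α - 1) * η ^ ((α - 1) / α) := by ring
      _ ≤ 2 * α * r / (2 - α) * (Real.sqrt d * η ^ ((α - 2) / α)) +
          α / (α - 1) * η ^ ((α - 1) / α) := by gcongr
      _ = _ := by ring
end
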